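/- Let Ω ⊂ ℝ^N be a bounded domain with C^1 boundary which is starshaped with respect to the origin, and suppose that the mapping t ↦ g(t)·t^{1−N} is strictly decreasing on (0,∞). Let u be a weak solution of the boundary value problem −div((g(|∇u|)/|∇u|)∇u) = f(u) in Ω, u = 0 on ∂Ω, satisfying ∂u/∂ν = 0 on ∂Ω, and suppose u is a local minimizer of J in X. Then u ≡ 0 in Ω. -/

import Mathlib

open Set Metric MeasureTheory Bornology
open scoped RealInnerProductSpace Classical

noncomputable section

/-- The vector field `y ↦ (g(|y|)/|y|)·y`, with the convention that it vanishes at `y = 0`. -/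
def gvec {N : ℕ} (g : ℝ → ℝ) (y : EuclideanSpace ℝ (Fin N)) : EuclideanSpace ℝ (Fin N) :=
  if y = 0 then 0 else (g ‖y‖ / ‖y‖) • y

/-- `φ` is a smooth test function compactly supported in `Ω`. -/
def IsTestFun {N : ℕ} (Ω : Set (EuclideanSpace ℝ (Fin N)))
    (φ : EuclideanSpace ℝ (Fin N) → ℝ) : Prop :=
  ContDiff ℝ (⊤ : ℕ∞) φ ∧ HasCompactSupport φ ∧ tsupport φ ⊆ Ω

/-- Conditions (2.1)-(2.2): `g ∈ C[0,∞) ∩ C¹(0,∞)`, `g(0) = 0`, `g'(t) > 0` for `t > 0`. -/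
def GCond (g : ℝ → ℝ) : Prop :=
  ContinuousOn g (Ici 0) ∧ ContDiffOn ℝ 1 g (Ioi 0) ∧ g 0 = 0 ∧
    ∀ t : ℝ, 0 < t → 0 < deriv g t

/-- Conditions (2.3)-(2.4): `f ∈ C([0,R] × [0,∞))`, `r ↦ f(r,t)` non-increasing. -/
def FCond (R : ℝ) (f : ℝ → ℝ → ℝ) : Prop :=
  ContinuousOn (fun q : ℝ × ℝ => f q.1 q.2) (Icc 0 R ×ˢ Ici 0) ∧
    ∀ t : ℝ, 0 ≤ t → ∀ r₁ ∈ Icc (0:ℝ) R, ∀ r₂ ∈ Icc (0:ℝ) R, r₁ ≤ r₂ → f r₂ t ≤ f r₁ t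

/-- `u` solves `-div((g(|∇u|)/|∇u|)∇u) = f(|x|,u)` distributionally in the ball `B_R`. -/
def IsDistribSolBall {N : ℕ} (R : ℝ) (g : ℝ → ℝ) (f : ℝ → ℝ → ℝ)
    (u : EuclideanSpace ℝ (Fin N) → ℝ) : Prop :=
  ∀ φ : EuclideanSpace ℝ (Fin N) → ℝ, IsTestFun (ball 0 R) φ →
    (∫ x in ball (0:EuclideanSpace ℝ (Fin N)) R, ⟪gvec g (gradient u x), gradient φ x⟫) =
      ∫ x in ball (0:EuclideanSpace ℝ (Fin N)) R, f ‖x‖ (u x) * φ x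

/-- `u` is a weak solution of problem (P): `u ∈ C¹(clos B_R)`, `u ≥ 0`, `u ≢ 0`,
`u = 0` on `∂B_R`, and the equation holds distributionally. -/
def IsWeakSolP {N : ℕ} (R : ℝ) (g : ℝ → ℝ) (f : ℝ → ℝ → ℝ)
    (u : EuclideanSpace ℝ (Fin N) → ℝ) : Prop :=
  ContDiffOn ℝ 1 u (closedBall 0 R) ∧
  (∀ x ∈ closedBall (0:EuclideanSpace ℝ (Fin N)) R, 0 ≤ u x) ∧
  (∃ x ∈ closedBall (0:EuclideanSpace ℝ (Fin N)) R, u x ≠ 0) ∧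
  (∀ x ∈ sphere (0:EuclideanSpace ℝ (Fin N)) R, u x = 0) ∧
  IsDistribSolBall R g f u

/-- `U` is `C¹` on `[a,b]` with (continuous) derivative `U'`. -/
def C1On (U U' : ℝ → ℝ) (a b : ℝ) : Prop :=
  ContinuousOn U' (Icc a b) ∧ ∀ r ∈ Icc a b, HasDerivWithinAt U (U' r) (Icc a b) r

/-- Definition 2.1: `u` is locally symmetric in `B_R`. -/
def LocallySymmetric {N : ℕ} (R : ℝ) (u : EuclideanSpace ℝ (Fin N) → ℝ) : Prop :=
  ∃ (K : Set ℕ) (z : ℕ → EuclideanSpace ℝ (Fin N)) (ri ro : ℕ → ℝ) (U U' : ℕ → ℝ → ℝ),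
    (∀ k ∈ K, z k ∈ ball (0:EuclideanSpace ℝ (Fin N)) R ∧ 0 ≤ ri k ∧ ri k < ro k) ∧
    K.PairwiseDisjoint (fun k => ball (z k) (ro k) \ closedBall (z k) (ri k)) ∧
    ball (0:EuclideanSpace ℝ (Fin N)) R =
      (⋃ k ∈ K, ball (z k) (ro k) \ closedBall (z k) (ri k)) ∪
        {x ∈ ball (0:EuclideanSpace ℝ (Fin N)) R | gradient u x = 0} ∧
    ∀ k ∈ K,
      C1On (U k) (U' k) (ri k) (ro k) ∧
      (∀ x ∈ ball (z k) (ro k) \ closedBall (z k) (ri k), u x = U k ‖x - z k‖) ∧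
      (∀ r ∈ Ioo (ri k) (ro k), U' k r < 0) ∧
      (∀ x ∈ ball (z k) (ri k), U k (ri k) ≤ u x)

/-- `H(t) = t·g(t) - ∫₀ᵗ g(s) ds`. -/
def Hfun (g : ℝ → ℝ) (t : ℝ) : ℝ := t * g t - ∫ s in (0:ℝ)..t, g s

/-- The inverse of `H` on `[0,∞)`. -/
def Hinv (g : ℝ → ℝ) : ℝ → ℝ := Function.invFunOn (Hfun g) (Ici 0)

/-- The class `A_g` of Definition 3.1. -/
def MemAg (g φ : ℝ → ℝ) : Prop :=
  ContinuousOn φ (Ici 0) ∧ (∀ t : ℝ, 0 ≤ t → 0 ≤ φ t) ∧ φ 0 = 0 ∧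
  ((∃ d > (0:ℝ), ∀ t ∈ Icc (0:ℝ) d, φ t = 0) ∨
    ∃ δ > (0:ℝ), (∀ t ∈ Ioo (0:ℝ) δ, 0 < φ t) ∧
      ∫⁻ t in Ioc (0:ℝ) δ, ENNReal.ofReal (1 / Hinv g (∫ s in (0:ℝ)..t, φ s)) = ⊤)

/-- `u` satisfies `div((g(|∇u|)/|∇u|)∇u) ≤ φ(u)` distributionally in `Ω`. -/
def DistribSupIneq {N : ℕ} (Ω : Set (EuclideanSpace ℝ (Fin N))) (g φ : ℝ → ℝ)
    (u : EuclideanSpace ℝ (Fin N) → ℝ) : Prop :=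
  ∀ ψ : EuclideanSpace ℝ (Fin N) → ℝ, IsTestFun Ω ψ → (∀ x, 0 ≤ ψ x) →
    -(∫ x in Ω, ⟪gvec g (gradient u x), gradient ψ x⟫) ≤ ∫ x in Ω, φ (u x) * ψ x

/-- Condition (a) of Lemma 3.7. -/
def CondA (R : ℝ) (g : ℝ → ℝ) (f : ℝ → ℝ → ℝ) : Prop :=
  ∀ ρ ∈ Ico (0:ℝ) R, ∀ τ : ℝ, 0 < τ → f ρ τ = 0 →
    ∃ δ ∈ Ioo (0:ℝ) τ, ∃ φ : ℝ → ℝ, MemAg g φ ∧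
      ∀ t ∈ Icc (τ - δ) τ, ∀ r ∈ Icc (ρ - δ) (ρ + δ) ∩ Icc (0:ℝ) R, f r t ≤ φ (τ - t)

/-- Condition (b) of Lemma 3.8. -/
def CondB (R : ℝ) (g : ℝ → ℝ) (f : ℝ → ℝ → ℝ) : Prop :=
  ∀ ρ ∈ Ico (0:ℝ) R, f ρ 0 = 0 →
    ∃ δ > (0:ℝ), ∃ φ : ℝ → ℝ, MemAg g φ ∧
      ∀ r ∈ Ico (0:ℝ) R, ∀ t ∈ Icc (0:ℝ) δ, -f r t ≤ φ t

/-- Condition (c) of Theorem 3.9. -/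
def CondC (R : ℝ) (g : ℝ → ℝ) (f : ℝ → ℝ → ℝ) : Prop :=
  ∀ ρ ∈ Ico (0:ℝ) R, ∀ τ : ℝ, 0 ≤ τ → f ρ τ = 0 →
    ∃ δ > (0:ℝ), ∃ φ : ℝ → ℝ, MemAg g φ ∧
      ∀ t ∈ Icc τ (τ + δ), ∀ r ∈ Icc (ρ - δ) (ρ + δ) ∩ Icc (0:ℝ) R, -f r t ≤ φ (t - τ)

/-- `u` solves `-div((g(|∇u|)/|∇u|)∇u) = f(u)` distributionally in `Ω` (autonomous case). -/
def IsDistribSolAut {N : ℕ} (Ω : Set (EuclideanSpace ℝ (Fin N))) (g f : ℝ → ℝ)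
    (u : EuclideanSpace ℝ (Fin N) → ℝ) : Prop :=
  ∀ φ : EuclideanSpace ℝ (Fin N) → ℝ, IsTestFun Ω φ →
    (∫ x in Ω, ⟪gvec g (gradient u x), gradient φ x⟫) = ∫ x in Ω, f (u x) * φ x

/-- `u` is a weak solution of problem (P) with autonomous right-hand side `f = f(u)`. -/
def IsWeakSolPAut {N : ℕ} (R : ℝ) (g f : ℝ → ℝ) (u : EuclideanSpace ℝ (Fin N) → ℝ) : Prop :=
  ContDiffOn ℝ 1 u (closedBall 0 R) ∧
  (∀ x ∈ closedBall (0:EuclideanSpace ℝ (Fin N)) R, 0 ≤ u x) ∧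
  (∃ x ∈ closedBall (0:EuclideanSpace ℝ (Fin N)) R, u x ≠ 0) ∧
  (∀ x ∈ sphere (0:EuclideanSpace ℝ (Fin N)) R, u x = 0) ∧
  IsDistribSolAut (ball 0 R) g f u

/-- `G(t) = ∫₀ᵗ g(s) ds`. -/
def Gfun (g : ℝ → ℝ) (t : ℝ) : ℝ := ∫ s in (0:ℝ)..t, g s

/-- The variational functional `J(v) = ∫_Ω (G(|∇v|) - F(v)) dx`. -/
def Jfun {N : ℕ} (g f : ℝ → ℝ) (Ω : Set (EuclideanSpace ℝ (Fin N)))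
    (v : EuclideanSpace ℝ (Fin N) → ℝ) : ℝ :=
  ∫ x in Ω, (Gfun g ‖gradient v x‖ - Gfun f (v x))

/-- `v ∈ X`, i.e. `v ∈ C¹(clos Ω)` with `v = 0` on `∂Ω`. -/
def MemX {N : ℕ} (Ω : Set (EuclideanSpace ℝ (Fin N)))
    (v : EuclideanSpace ℝ (Fin N) → ℝ) : Prop :=
  ContDiffOn ℝ 1 v (closure Ω) ∧ ∀ x ∈ frontier Ω, v x = 0

/-- `u` is a global minimizer of `J` in `X`. -/
def IsGlobalMinJ {N : ℕ} (g f : ℝ → ℝ) (Ω : Set (EuclideanSpace ℝ (Fin N)))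
    (u : EuclideanSpace ℝ (Fin N) → ℝ) : Prop :=
  MemX Ω u ∧ ∀ v, MemX Ω v → Jfun g f Ω u ≤ Jfun g f Ω v

/-- `u` is a local minimizer of `J` in `X` (w.r.t. the `C¹` distance). -/
def IsLocalMinJ {N : ℕ} (g f : ℝ → ℝ) (Ω : Set (EuclideanSpace ℝ (Fin N)))
    (u : EuclideanSpace ℝ (Fin N) → ℝ) : Prop :=
  MemX Ω u ∧ ∃ ε > (0:ℝ), ∀ v, MemX Ω v →
    (∀ x ∈ Ω, |v x - u x| + ‖gradient v x - gradient u x‖ < ε) →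
    Jfun g f Ω u ≤ Jfun g f Ω v

/-- `Ω` has `C¹` boundary: near every boundary point, `Ω` is the sublevel set of a `C¹`
defining function with nonvanishing gradient. -/
def HasC1Boundary {N : ℕ} (Ω : Set (EuclideanSpace ℝ (Fin N))) : Prop :=
  ∀ y ∈ frontier Ω, ∃ (V : Set (EuclideanSpace ℝ (Fin N))) (ρ : EuclideanSpace ℝ (Fin N) → ℝ),
    IsOpen V ∧ y ∈ V ∧ ContDiffOn ℝ 1 ρ V ∧ (∀ x ∈ V, (x ∈ Ω ↔ ρ x < 0)) ∧ gradient ρ y ≠ 0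

/-- The Neumann condition `∂u/∂ν = 0` on `∂Ω`; for `u ∈ X` (so that `u` vanishes on the
boundary and all tangential derivatives vanish) this is equivalent to the vanishing of the
full derivative of `u` (within `clos Ω`) at every boundary point. -/
def NeumannZero {N : ℕ} (Ω : Set (EuclideanSpace ℝ (Fin N)))
    (u : EuclideanSpace ℝ (Fin N) → ℝ) : Prop :=
  ∀ y ∈ frontier Ω, HasFDerivWithinAt u (0 : EuclideanSpace ℝ (Fin N) →L[ℝ] ℝ) (closure Ω) y

/-- `u` is radially symmetric and radially non-increasing on `clos B_R`, with `C¹`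
profile `U` (with derivative `U'`). -/
def RadialNonincreasing {N : ℕ} (R : ℝ) (u : EuclideanSpace ℝ (Fin N) → ℝ)
    (U U' : ℝ → ℝ) : Prop :=
  C1On U U' 0 R ∧ AntitoneOn U (Icc 0 R) ∧
    ∀ x ∈ closedBall (0:EuclideanSpace ℝ (Fin N)) R, u x = U ‖x‖

end
open Set Metric MeasureTheory Bornology
open scoped RealInnerProductSpace Classical

lemma aux_Gderiv {g : ℝ → ℝ} (hgc : ContinuousOn g (Ici 0)) {t : ℝ} (ht : 0 < t) :
    HasDerivAt (Gfun g) (g t) t := by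
  unfold Gfun
  apply intervalIntegral.integral_hasDerivAt_right
  · apply ContinuousOn.intervalIntegrable
    rw [uIcc_of_le ht.le]
    exact hgc.mono (fun x hx => hx.1)
  · exact (hgc.mono Ioi_subset_Ici_self).stronglyMeasurableAtFilter isOpen_Ioi t ht
  · exact hgc.continuousAt (Ici_mem_nhds ht)

lemma aux_ii {g : ℝ → ℝ} (hgc : ContinuousOn g (Ici 0)) {a b : ℝ} (ha : 0 ≤ a) (hb : 0 ≤ b) :
    IntervalIntegrable g volume a b := by
  apply ContinuousOn.intervalIntegrable
  apply hgc.mono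
  intro x hx
  rcases le_total a b with h | h
  · rw [uIcc_of_le h] at hx; exact ha.trans hx.1
  · rw [uIcc_of_ge h] at hx; exact hb.trans hx.1

lemma aux_Gsub {g : ℝ → ℝ} (hgc : ContinuousOn g (Ici 0)) {a b : ℝ} (ha : 0 ≤ a) (hb : 0 ≤ b) :
    Gfun g b - Gfun g a = ∫ s in a..b, g s := by
  unfold Gfun
  exact intervalIntegral.integral_interval_sub_left (aux_ii hgc le_rfl hb) (aux_ii hgc le_rfl ha)

lemma aux_Gzero (g : ℝ → ℝ) : Gfun g 0 = 0 := by simp [Gfun]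

/-- upper and lower linear bounds for G -/
lemma aux_Gbound {g : ℝ → ℝ} (hgc : ContinuousOn g (Ici 0)) (hgm : StrictMonoOn g (Ici 0))
    {a b : ℝ} (ha : 0 ≤ a) (hab : a ≤ b) : Gfun g b - Gfun g a ≤ g b * (b - a) := by
  rw [aux_Gsub hgc ha (ha.trans hab)]
  calc ∫ s in a..b, g s ≤ ∫ s in a..b, g b := by
        apply intervalIntegral.integral_mono_on hab (aux_ii hgc ha (ha.trans hab)) (by simp)
        intro x hx
        exact hgm.monotoneOn (ha.trans hx.1) (ha.trans hab) hx.2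
    _ = g b * (b - a) := by simp [mul_comm]

lemma aux_gnn {g : ℝ → ℝ} (hgm : StrictMonoOn g (Ici 0)) (hg0 : g 0 = 0) {t : ℝ} (ht : 0 ≤ t) :
    0 ≤ g t := by
  rw [← hg0]; exact hgm.monotoneOn (by simp) ht ht

lemma aux_Gmono {g : ℝ → ℝ} (hgc : ContinuousOn g (Ici 0)) (hgm : StrictMonoOn g (Ici 0))
    (hg0 : g 0 = 0) {a b : ℝ} (ha : 0 ≤ a) (hab : a ≤ b) : Gfun g a ≤ Gfun g b := by
  have h := aux_Gsub hgc ha (ha.trans hab)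
  have : 0 ≤ ∫ s in a..b, g s :=
    intervalIntegral.integral_nonneg hab (fun x hx => aux_gnn hgm hg0 (ha.trans hx.1))
  linarith

lemma aux_Gcont {g : ℝ → ℝ} (hgc : ContinuousOn g (Ici 0)) : ContinuousOn (Gfun g) (Ici 0) := by
  intro x hx
  have hx : 0 ≤ x := hx
  have h := intervalIntegral.continuousOn_primitive_interval' (μ := volume)
    (aux_ii hgc le_rfl (by linarith : (0:ℝ) ≤ x + 1)) (a := 0) left_mem_uIcc
  have h1 : ContinuousWithinAt (Gfun g) (Icc 0 (x+1)) x := by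
    rw [uIcc_of_le (by linarith)] at h
    exact h x ⟨hx, by linarith⟩
  apply h1.mono_of_mem_nhdsWithin
  rw [← Ici_inter_Iic]
  exact inter_mem_nhdsWithin _ (Iic_mem_nhds (by linarith))

/-- strict monotonicity of `N G(s) - s g(s)`. -/
lemma aux_Mmono {N : ℕ} (hN : 1 ≤ N) {g : ℝ → ℝ} (hgc : ContinuousOn g (Ici 0))
    (hmon : StrictAntiOn (fun t : ℝ => g t * t ^ (1 - (N:ℝ))) (Ioi 0)) :
    StrictMonoOn (fun s => N * Gfun g s - s * g s) (Ioi 0) := by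
  have key : ∀ s : ℝ, 0 < s → s * (g s) = (g s * s ^ (1 - (N:ℝ))) * s ^ N := by
    intro s hs
    rw [mul_assoc, ← Real.rpow_natCast s N, ← Real.rpow_add hs]
    simp [mul_comm]
  have key2 : ∀ s : ℝ, 0 < s → (g s) = (g s * s ^ (1 - (N:ℝ))) * s ^ (N-1) := by
    intro s hs
    rw [mul_assoc, ← Real.rpow_natCast s (N-1), ← Real.rpow_add hs]
    simp [Nat.cast_sub hN]
  intro a ha b hb hab
  have ha : 0 < a := ha
  have hb : 0 < b := hb
  have hq := hmon ha hb hab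
  simp only at hq ⊢
  have hsub := aux_Gsub hgc ha.le hb.le
  have h1 : ∫ s in a..b, (g b * b ^ (1 - (N:ℝ))) * s ^ (N-1) ≤ ∫ s in a..b, g s := by
    apply intervalIntegral.integral_mono_on hab.le _ (aux_ii hgc ha.le hb.le)
    · intro x hx
      have hx0 : 0 < x := ha.trans_le hx.1
      rw [key2 x hx0]
      apply mul_le_mul_of_nonneg_right _ (by positivity)
      exact hmon.antitoneOn hx0 hb hx.2
    · apply Continuous.intervalIntegrable; fun_prop
  rw [intervalIntegral.integral_const_mul, integral_pow] at h1
  have hN' : (N - 1 + 1 : ℕ) = N := by omega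
  have hN2 : ((N - 1 : ℕ) : ℝ) + 1 = N := by exact_mod_cast hN'
  rw [hN', hN2] at h1
  have hNp : (0:ℝ) < N := by exact_mod_cast hN
  have h2 : (g b * b ^ (1 - (N:ℝ))) * (b^N - a^N) ≤ N * ∫ s in a..b, g s := by
    calc _ = N * ((g b * b ^ (1 - (N:ℝ))) * ((b^N - a^N)/N)) := by field_simp
      _ ≤ _ := by gcongr
  have h3 := key a ha
  have h4 := key b hb
  have h5 : (g b * b ^ (1 - (N:ℝ))) * a^N < (g a * a ^ (1 - (N:ℝ))) * a^N :=
    mul_lt_mul_of_pos_right hq (by positivity)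
  rw [h3, h4]
  nlinarith

lemma aux_phi_concave {N : ℕ} (hN : 1 ≤ N) {g : ℝ → ℝ} (hgc : ContinuousOn g (Ici 0))
    (hmon : StrictAntiOn (fun t : ℝ => g t * t ^ (1 - (N:ℝ))) (Ioi 0)) {p : ℝ} (hp : 0 < p) :
    StrictConcaveOn ℝ (Ioi 0) (fun τ : ℝ => τ * Gfun g (τ ^ (-(1:ℝ)/N) * p)) := by
  have hNp : (0:ℝ) < N := by exact_mod_cast hN
  have hd : ∀ τ : ℝ, 0 < τ → HasDerivAt (fun τ : ℝ => τ * Gfun g (τ ^ (-(1:ℝ)/N) * p))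
      ((1/N) * (N * Gfun g (τ ^ (-(1:ℝ)/N) * p) -
        (τ ^ (-(1:ℝ)/N) * p) * g (τ ^ (-(1:ℝ)/N) * p))) τ := by
    intro τ hτ
    have h1 : HasDerivAt (fun τ : ℝ => τ ^ (-(1:ℝ)/N)) ((-(1:ℝ)/N) * τ ^ (-(1:ℝ)/N - 1)) τ :=
      Real.hasDerivAt_rpow_const (Or.inl hτ.ne')
    have h2 := (aux_Gderiv hgc (t := τ ^ (-(1:ℝ)/N) * p) (by positivity)).comp τ (h1.mul_const p)
    have h3 := (hasDerivAt_id τ).mul h2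
    refine h3.congr_deriv ?_
    have : τ ^ (-(1:ℝ)/N - 1) = τ ^ (-(1:ℝ)/N) / τ := by
      rw [Real.rpow_sub hτ, Real.rpow_one]
    simp only [Function.comp, id]
    rw [this]
    field_simp
    ring
  apply StrictAntiOn.strictConcaveOn_of_deriv (convex_Ioi 0)
  · intro τ hτ
    exact (hd τ hτ).continuousAt.continuousWithinAt
  · rw [interior_Ioi]
    intro a ha b hb hab
    rw [(hd a ha).deriv, (hd b hb).deriv]
    have ha : 0 < a := ha
    have hb : 0 < b := hb
    apply mul_lt_mul_of_pos_left _ (by positivity)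
    apply aux_Mmono hN hgc hmon
    · exact mul_pos (Real.rpow_pos_of_pos hb _) hp
    · exact mul_pos (Real.rpow_pos_of_pos ha _) hp
    · apply mul_lt_mul_of_pos_right _ hp
      apply Real.rpow_lt_rpow_of_neg ha hab
      apply div_neg_of_neg_of_pos (by norm_num) hNp

lemma aux_concave_contra {k : ℝ → ℝ} (hk : StrictConcaveOn ℝ (Ioi 0) k)
    (hA : ∃ a0 > (0:ℝ), ∀ τ, 1 - a0 < τ → τ < 1 → k 1 ≤ k τ)
    (hB : ∀ ω > (0:ℝ), ∃ b0 > (0:ℝ), ∀ b, 0 < b → b < b0 → k 1 - ω * b ≤ k (1 + b)) : False := by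
  obtain ⟨a0, ha0, hA⟩ := hA
  set a := min (a0/2) (1/2) with ha
  have hap : 0 < a := by positivity
  have ha1 : a ≤ a0/2 := min_le_left _ _
  have ha2 : a ≤ 1/2 := min_le_right _ _
  have h1 := hk.slope_anti_adjacent (x := 1 - a) (y := 1 - a/2) (z := 1)
    (by simp; linarith) (by simp) (by linarith) (by linarith)
  have h0 := hA (1 - a) (by linarith) (by linarith)
  have h0' := hA (1 - a/2) (by linarith) (by linarith)
  have hD : k 1 - k (1 - a/2) < 0 := by
    rcases h0'.lt_or_eq with h | h
    · linarith
    · rw [h] at h1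
      have e1 : (1 - a/2 - (1 - a)) = a/2 := by ring
      have e2 : (1 - (1 - a/2)) = a/2 := by ring
      rw [e1, e2] at h1
      have := (div_lt_div_iff_of_pos_right (by positivity : 0 < a/2)).1 h1
      linarith
  set ω := - (k 1 - k (1 - a/2)) / (a/2) with hω
  have hωp : 0 < ω := by rw [hω]; apply div_pos <;> linarith
  obtain ⟨b0, hb0, hB⟩ := hB ω hωp
  have h2 := hB (b0/2) (by positivity) (by linarith)
  have h3 := hk.slope_anti_adjacent (x := 1 - a/2) (y := 1) (z := 1 + b0/2)
    (by simp; linarith) (by simp; linarith) (by linarith) (by linarith)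
  have e2 : (1 - (1 - a/2)) = a/2 := by ring
  have e3 : (1 + b0/2 - 1) = b0/2 := by ring
  rw [e2, e3] at h3
  have h4 : (k 1 - k (1 - a/2)) / (a/2) = -ω := by rw [hω]; ring
  rw [h4, div_lt_iff₀ (by positivity)] at h3
  linarith

open Set Metric MeasureTheory Bornology
open scoped RealInnerProductSpace Classical

abbrev EE (N : ℕ) := EuclideanSpace ℝ (Fin N)

/-- scaled energy -/
noncomputable def Kfun {N : ℕ} (g : ℝ → ℝ) (U : EE N → ℝ) (B : ℝ) (l : ℝ) : ℝ :=
  l ^ N * ((∫ x, Gfun g (l⁻¹ * ‖fderiv ℝ U x‖)) - B)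

lemma aux_Gp_cont {N : ℕ} {g : ℝ → ℝ} (hgc : ContinuousOn g (Ici 0)) {U : EE N → ℝ}
    (hU : ContDiff ℝ 1 U) {c : ℝ} (hc : 0 ≤ c) :
    Continuous (fun x => Gfun g (c * ‖fderiv ℝ U x‖)) := by
  apply (aux_Gcont hgc).comp_continuous
  · have := hU.continuous_fderiv (by norm_num)
    fun_prop
  · intro x; simp only [mem_Ici]; positivity

lemma aux_Gp_supp {N : ℕ} {g : ℝ → ℝ} {U : EE N → ℝ} (hUc : HasCompactSupport U) (c : ℝ) :
    HasCompactSupport (fun x => Gfun g (c * ‖fderiv ℝ U x‖)) := by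
  have := hUc.fderiv (𝕜 := ℝ)
  apply this.comp_left (g := fun L => Gfun g (c * ‖L‖))
  simp [aux_Gzero]

lemma aux_k_concave {N : ℕ} (hN : 1 ≤ N) {g : ℝ → ℝ} (hgc : ContinuousOn g (Ici 0))
    (hmon : StrictAntiOn (fun t : ℝ => g t * t ^ (1 - (N:ℝ))) (Ioi 0))
    {U : EE N → ℝ} (hU : ContDiff ℝ 1 U) (hUc : HasCompactSupport U) (B : ℝ)
    (hne : ∃ x, fderiv ℝ U x ≠ 0) :
    StrictConcaveOn ℝ (Ioi 0)
      (fun τ : ℝ => (∫ x, τ * Gfun g (τ ^ (-(1:ℝ)/N) * ‖fderiv ℝ U x‖)) - τ * B) := by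
  refine ⟨convex_Ioi 0, ?_⟩
  intro a ha b hb hab s t hs ht hst
  have ha : 0 < a := ha
  have hb : 0 < b := hb
  have hcont : ∀ τ : ℝ, 0 < τ → Continuous (fun x => τ * Gfun g (τ ^ (-(1:ℝ)/N) * ‖fderiv ℝ U x‖)) :=
    fun τ hτ => (aux_Gp_cont hgc hU (by positivity)).const_smul τ
  have hsupp : ∀ τ : ℝ, HasCompactSupport (fun x => τ * Gfun g (τ ^ (-(1:ℝ)/N) * ‖fderiv ℝ U x‖)) :=
    fun τ => (aux_Gp_supp hUc _).mul_left (f := fun _ => τ)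
  have hIntg0 : ∀ τ : ℝ, 0 < τ → Integrable (fun x => τ * Gfun g (τ ^ (-(1:ℝ)/N) * ‖fderiv ℝ U x‖)) :=
    fun τ hτ => (hcont τ hτ).integrable_of_hasCompactSupport (hsupp τ)
  set c := s • a + t • b with hc
  have hcp : 0 < c := by simp only [hc, smul_eq_mul]; positivity
  set D : EE N → ℝ := fun x => c * Gfun g (c ^ (-(1:ℝ)/N) * ‖fderiv ℝ U x‖) -
    (s * (a * Gfun g (a ^ (-(1:ℝ)/N) * ‖fderiv ℝ U x‖)) +
      t * (b * Gfun g (b ^ (-(1:ℝ)/N) * ‖fderiv ℝ U x‖))) with hD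
  have hDpos : ∀ x, fderiv ℝ U x ≠ 0 → 0 < D x := by
    intro x hx
    have := (aux_phi_concave hN hgc hmon (norm_pos_iff.2 hx)).2 ha hb hab hs ht hst
    simp only [smul_eq_mul] at this
    simp only [hD, hc, smul_eq_mul]
    linarith
  have hDz : ∀ x, fderiv ℝ U x = 0 → D x = 0 := by
    intro x hx
    simp [hD, hx, aux_Gzero]
  have hDI : 0 < ∫ x, D x := by
    obtain ⟨x0, hx0⟩ := hne
    apply Continuous.integral_pos_of_hasCompactSupport_nonneg_nonzero (x := x0)
    · exact (hcont c hcp).sub (((hcont a ha).const_smul s).add ((hcont b hb).const_smul t))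
    · apply (hUc.fderiv (𝕜 := ℝ)).mono
      intro x hx
      simp only [Function.mem_support] at hx ⊢
      exact fun h => hx (hDz x h)
    · intro x
      by_cases h : fderiv ℝ U x = 0
      · simp [hDz x h]
      · exact (hDpos x h).le
    · exact (hDpos x0 hx0).ne'
  have e : ∫ x, D x = (∫ x, c * Gfun g (c ^ (-(1:ℝ)/N) * ‖fderiv ℝ U x‖)) -
      (s * (∫ x, a * Gfun g (a ^ (-(1:ℝ)/N) * ‖fderiv ℝ U x‖)) +
      t * (∫ x, b * Gfun g (b ^ (-(1:ℝ)/N) * ‖fderiv ℝ U x‖))) := by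
    rw [← integral_const_mul, ← integral_const_mul, ← integral_add, ← integral_sub]
    · exact hIntg0 c hcp
    · exact ((hIntg0 a ha).const_mul s).add ((hIntg0 b hb).const_mul t)
    · exact (hIntg0 a ha).const_mul s
    · exact (hIntg0 b hb).const_mul t
  rw [e] at hDI
  simp only [smul_eq_mul] at hc ⊢
  have hcB : c * B = s * (a * B) + t * (b * B) := by rw [hc]; ring
  linarith

lemma aux_final {N : ℕ} (hN : 1 ≤ N) {g : ℝ → ℝ} (hgc : ContinuousOn g (Ici 0))
    (hmon : StrictAntiOn (fun t : ℝ => g t * t ^ (1 - (N:ℝ))) (Ioi 0))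
    {U : EE N → ℝ} (hU : ContDiff ℝ 1 U) (hUc : HasCompactSupport U) (B : ℝ)
    (hA : ∃ a0 > (0:ℝ), ∀ l, 1 - a0 < l → l < 1 → Kfun g U B 1 ≤ Kfun g U B l)
    (hB : ∀ ω > (0:ℝ), ∃ e0 > (0:ℝ), ∀ e, 0 < e → e < e0 →
      Kfun g U B 1 - ω * e ≤ Kfun g U B (1 + e)) :
    ∀ x, fderiv ℝ U x = 0 := by
  by_contra! hne
  have hNp : (0:ℝ) < N := by exact_mod_cast hN
  have hk := aux_k_concave hN hgc hmon hU hUc B hne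
  have hKk : ∀ τ : ℝ, 0 < τ → Kfun g U B (τ ^ ((1:ℝ)/N)) =
      (∫ x, τ * Gfun g (τ ^ (-(1:ℝ)/N) * ‖fderiv ℝ U x‖)) - τ * B := by
    intro τ hτ
    have h1 : (τ ^ ((1:ℝ)/N)) ^ N = τ := by
      rw [one_div]; exact Real.rpow_inv_natCast_pow hτ.le (by omega)
    have h2 : (τ ^ ((1:ℝ)/N))⁻¹ = τ ^ (-(1:ℝ)/N) := by
      rw [← Real.rpow_neg hτ.le, neg_div]
    rw [Kfun, h1, h2, integral_const_mul]; ring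
  have hK1 : Kfun g U B 1 = (∫ x, 1 * Gfun g (1 ^ (-(1:ℝ)/N) * ‖fderiv ℝ U x‖)) - 1 * B := by
    rw [← hKk 1 one_pos, Real.one_rpow]
  apply aux_concave_contra hk
  · obtain ⟨a0, ha0, hA⟩ := hA
    set a1 := min a0 1 / 2 with ha1
    have ha1p : 0 < a1 := by positivity
    have h1 : a1 ≤ 1/2 := by rw [ha1]; linarith [min_le_right a0 1]
    have h2 : a1 < a0 := by rw [ha1]; linarith [min_le_left a0 1]
    refine ⟨a1, ha1p, fun τ hτ hτ1 => ?_⟩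
    have hτ0 : 0 < τ := by linarith
    rw [← hK1, ← hKk τ hτ0]
    apply hA
    · have : τ ≤ τ ^ ((1:ℝ)/N) := by
        conv_lhs => rw [← Real.rpow_one τ]
        apply Real.rpow_le_rpow_of_exponent_ge hτ0 hτ1.le
        rw [div_le_one hNp]; exact_mod_cast hN
      linarith
    · exact Real.rpow_lt_one hτ0.le hτ1 (by positivity)
  · intro ω hω
    obtain ⟨e0, he0, hB⟩ := hB ω hω
    refine ⟨e0, he0, fun b hb hb0 => ?_⟩
    have hb1 : 0 < 1 + b := by linarith
    rw [← hK1, ← hKk (1+b) hb1]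
    have h1 : (1 + b) ^ ((1:ℝ)/N) ≤ 1 + b := by
      conv_rhs => rw [← Real.rpow_one (1+b)]
      apply Real.rpow_le_rpow_of_exponent_le (by linarith)
      rw [div_le_one hNp]; exact_mod_cast hN
    have h2 : 1 < (1 + b) ^ ((1:ℝ)/N) := Real.one_lt_rpow (by linarith) (by positivity)
    have h3 := hB ((1 + b) ^ ((1:ℝ)/N) - 1) (by linarith) (by linarith)
    rw [add_sub_cancel] at h3
    refine le_trans ?_ h3
    have : ω * ((1 + b) ^ ((1:ℝ)/N) - 1) ≤ ω * b := by
      apply mul_le_mul_of_nonneg_left _ hω.le; linarith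
    linarith

open Set Metric MeasureTheory Bornology
open scoped RealInnerProductSpace Classical

lemma aux_ev_neg {r : ℝ → ℝ} {d : ℝ} (hr : HasDerivAt r d 0) (hd : d < 0) (h0 : r 0 ≤ 0) :
    ∀ᶠ t in nhdsWithin (0:ℝ) (Ioi 0), r t < 0 := by
  have h := hr.hasDerivWithinAt (s := Ioi 0)
  have h1 := (hasDerivWithinAt_iff_tendsto_slope' (by simp)).1 h
  have h2 := h1.eventually (gt_mem_nhds hd)
  filter_upwards [h2, self_mem_nhdsWithin] with t ht htp
  have htp : 0 < t := htp
  rw [slope_def_field, sub_zero, div_lt_iff₀ htp] at ht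
  linarith

lemma aux_uniqueDiff {N : ℕ} {Ω : Set (EE N)} (hΩo : IsOpen Ω) (hΩbd : HasC1Boundary Ω) :
    UniqueDiffOn ℝ (closure Ω) := by
  intro y hy
  by_cases hyΩ : y ∈ Ω
  · exact (hΩo.uniqueDiffWithinAt hyΩ).mono subset_closure
  have hyf : y ∈ frontier Ω := by rw [hΩo.frontier_eq]; exact ⟨hy, hyΩ⟩
  obtain ⟨V, ρ, hV, hyV, hρ, hiff, hgrad⟩ := hΩbd y hyf
  refine UniqueDiffWithinAt.mono ?_ (subset_closure)
  have hdiff : DifferentiableAt ℝ ρ y :=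
    ((hρ y hyV).contDiffAt (hV.mem_nhds hyV)).differentiableAt (by norm_num)
  set D := fderiv ℝ ρ y with hD
  have hD0 : D ≠ 0 := by
    intro h
    apply hgrad
    unfold gradient
    rw [← hD, h]; simp
  have hρy : ρ y ≤ 0 := by
    have hc : ContinuousWithinAt ρ (Ω ∩ V) y := hdiff.continuousAt.continuousWithinAt
    have hm : y ∈ closure (Ω ∩ V) := by
      rw [mem_closure_iff_nhds]
      intro t ht
      obtain ⟨z, hz1, hz2⟩ := mem_closure_iff_nhds.1 hy (t ∩ V) (Filter.inter_mem ht (hV.mem_nhds hyV))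
      exact ⟨z, hz1.1, hz2, hz1.2⟩
    have : (nhdsWithin y (Ω ∩ V)).NeBot := mem_closure_iff_nhdsWithin_neBot.1 hm
    apply le_of_tendsto hc
    filter_upwards [self_mem_nhdsWithin] with x hx
    exact ((hiff x hx.2).1 hx.1).le
  have hcone : ∀ v, D v < 0 → v ∈ Submodule.span ℝ (tangentConeAt ℝ Ω y) := by
    intro v hv
    have hline : HasDerivAt (fun t : ℝ => y + t • v) v 0 := by
      simpa using ((hasDerivAt_id (0:ℝ)).smul_const v).const_add y
    have hcomp : HasDerivAt (fun t : ℝ => ρ (y + t • v)) (D v) 0 := by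
      have : HasFDerivAt ρ D (y + (0:ℝ) • v) := by simpa using hdiff.hasFDerivAt
      exact this.comp_hasDerivAt (0:ℝ) hline
    have e1 := aux_ev_neg hcomp hv (by simpa using hρy)
    have e2 : ∀ᶠ t in nhdsWithin (0:ℝ) (Ioi 0), y + t • v ∈ V := by
      apply Filter.Eventually.filter_mono nhdsWithin_le_nhds
      apply hline.continuousAt.eventually
      exact hV.mem_nhds (by simpa using hyV)
    have e3 := e1.and e2
    rw [eventually_nhdsWithin_iff, Metric.eventually_nhds_iff] at e3
    obtain ⟨ε, hε, h⟩ := e3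
    have hseg : openSegment ℝ y (y + (ε/2) • v) ⊆ Ω := by
      rw [openSegment_eq_image']
      rintro _ ⟨θ, ⟨hθ0, hθ1⟩, rfl⟩
      have := h (y := θ * (ε/2)) (by
        rw [Real.dist_eq, sub_zero, abs_of_pos (by positivity)]; nlinarith) (by
        simp only [mem_Ioi]; positivity)
      simp only [add_sub_cancel_left, smul_smul]
      exact (hiff _ this.2).2 this.1
    have hm := mem_tangentConeAt_of_openSegment_subset hseg
    rw [add_sub_cancel_left] at hm
    have := Submodule.smul_mem _ (ε/2)⁻¹ (Submodule.subset_span (R := ℝ) hm)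
    rwa [smul_smul, inv_mul_cancel₀ (by positivity), one_smul] at this
  constructor
  · have : Submodule.span ℝ (tangentConeAt ℝ Ω y) = ⊤ := by
      rw [Submodule.eq_top_iff']
      intro w
      obtain ⟨v1, hv1⟩ : ∃ v, D v ≠ 0 := by
        by_contra! h
        exact hD0 (ContinuousLinearMap.ext h)
      obtain ⟨v0, hv0⟩ : ∃ v, D v < 0 := by
        rcases lt_or_gt_of_ne hv1 with h | h
        · exact ⟨v1, h⟩
        · exact ⟨-v1, by simpa using h⟩
      set c := (|D w| + 1) / (- D v0) with hc
      have h1 : w + c • v0 ∈ Submodule.span ℝ (tangentConeAt ℝ Ω y) := by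
        apply hcone
        have : c * (- D v0) = |D w| + 1 := by
          rw [hc]; field_simp [hv0.ne]
        simp only [map_add, map_smul, smul_eq_mul]
        linarith [le_abs_self (D w)]
      have h2 := Submodule.smul_mem _ c (hcone v0 hv0)
      have := Submodule.sub_mem _ h1 h2
      simpa using this
    rw [this]
    simp
  · exact hy

lemma aux_ext {N : ℕ} {Ω : Set (EE N)} (hΩo : IsOpen Ω) (hΩbd : HasC1Boundary Ω)
    {u : EE N → ℝ} (hX : MemX Ω u) (hneu : NeumannZero Ω u) :
    ContDiff ℝ 1 (Ω.indicator u) ∧ (∀ x ∉ Ω, fderiv ℝ (Ω.indicator u) x = 0) ∧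
      (∀ x ∈ closure Ω, Ω.indicator u x = u x) := by
  obtain ⟨hC, h0⟩ := hX
  have huniq := aux_uniqueDiff hΩo hΩbd
  have hcl : ∀ x ∈ closure Ω, Ω.indicator u x = u x := by
    intro x hx
    by_cases hxΩ : x ∈ Ω
    · simp [hxΩ]
    · have : x ∈ frontier Ω := by rw [hΩo.frontier_eq]; exact ⟨hx, hxΩ⟩
      simp [hxΩ, h0 x this]
  set W := fderivWithin ℝ u (closure Ω) with hW
  have hd : ∀ x, HasFDerivAt (Ω.indicator u) (Ω.indicator W x) x := by
    intro x
    by_cases hxΩ : x ∈ Ω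
    · have hn : closure Ω ∈ nhds x := Filter.mem_of_superset (hΩo.mem_nhds hxΩ) subset_closure
      have hdiff : DifferentiableAt ℝ u x :=
        ((hC x (subset_closure hxΩ)).contDiffAt hn).differentiableAt (by norm_num)
      rw [indicator_of_mem hxΩ, hW, fderivWithin_of_mem_nhds hn]
      apply hdiff.hasFDerivAt.congr_of_eventuallyEq
      filter_upwards [hΩo.mem_nhds hxΩ] with z hz
      simp [hz]
    · rw [indicator_of_notMem hxΩ]
      by_cases hxc : x ∈ closure Ω
      · have hxf : x ∈ frontier Ω := by rw [hΩo.frontier_eq]; exact ⟨hxc, hxΩ⟩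
        have h1 : HasFDerivWithinAt (Ω.indicator u) (0 : EE N →L[ℝ] ℝ) (closure Ω) x :=
          (hneu x hxf).congr hcl (hcl x hxc)
        have h2 : HasFDerivWithinAt (Ω.indicator u) (0 : EE N →L[ℝ] ℝ) (closure Ω)ᶜ x := by
          apply (hasFDerivWithinAt_const (0:ℝ) x (closure Ω)ᶜ).congr
          · intro z hz
            exact indicator_of_notMem (fun h => hz (subset_closure h)) _
          · exact indicator_of_notMem hxΩ _
        have := h1.union h2
        rwa [union_compl_self, hasFDerivWithinAt_univ] at this
      · apply (hasFDerivAt_const (0:ℝ) x).congr_of_eventuallyEq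
        filter_upwards [isClosed_closure.isOpen_compl.mem_nhds hxc] with z hz
        exact indicator_of_notMem (fun h => hz (subset_closure h)) _
  have hf : fderiv ℝ (Ω.indicator u) = Ω.indicator W := funext fun x => (hd x).fderiv
  refine ⟨?_, ?_, hcl⟩
  · rw [contDiff_one_iff_fderiv]
    refine ⟨fun x => (hd x).differentiableAt, ?_⟩
    rw [hf]
    apply continuous_indicator
    · intro a ha
      exact (hneu a ha).fderivWithin (huniq a (frontier_subset_closure ha))
    · exact hC.continuousOn_fderivWithin huniq (by norm_num)
  · intro x hx
    rw [hf, indicator_of_notMem hx]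

/-- whole space energy -/
noncomputable def jj {N : ℕ} (g f : ℝ → ℝ) (V : EE N → ℝ) : ℝ :=
  ∫ x, (Gfun g ‖fderiv ℝ V x‖ - Gfun f (V x))

lemma aux_norm_grad {N : ℕ} (v : EE N → ℝ) (x : EE N) : ‖gradient v x‖ = ‖fderiv ℝ v x‖ := by
  unfold gradient; simp

lemma aux_Jfun {N : ℕ} {g f : ℝ → ℝ} {Ω : Set (EE N)} (hΩo : IsOpen Ω) {v V : EE N → ℝ}
    (hvV : ∀ x ∈ Ω, v x = V x) (hV : ∀ x ∉ Ω, V x = 0 ∧ fderiv ℝ V x = 0) :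
    Jfun g f Ω v = jj g f V := by
  unfold Jfun jj
  rw [← setIntegral_eq_integral_of_forall_compl_eq_zero (s := Ω)
    (f := fun x => Gfun g ‖fderiv ℝ V x‖ - Gfun f (V x))]
  · apply setIntegral_congr_fun hΩo.measurableSet
    intro x hx
    have : v =ᶠ[nhds x] V := by
      filter_upwards [hΩo.mem_nhds hx] with z hz using hvV z hz
    simp only [aux_norm_grad, this.fderiv_eq, hvV x hx]
  · intro x hx
    simp [hV x hx, aux_Gzero]

lemma aux_min {N : ℕ} {g f : ℝ → ℝ} {Ω : Set (EE N)} (hΩo : IsOpen Ω) {u U : EE N → ℝ}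
    (huU : ∀ x ∈ Ω, u x = U x) (hU : ∀ x ∉ Ω, U x = 0 ∧ fderiv ℝ U x = 0)
    (hmin : IsLocalMinJ g f Ω u) :
    ∃ ε > (0:ℝ), ∀ V : EE N → ℝ, ContDiff ℝ 1 V → (∀ x ∉ Ω, V x = 0 ∧ fderiv ℝ V x = 0) →
      (∀ x ∈ Ω, |V x - U x| + ‖fderiv ℝ V x - fderiv ℝ U x‖ < ε) → jj g f U ≤ jj g f V := by
  obtain ⟨_, ε, hε, h⟩ := hmin
  refine ⟨ε, hε, fun V hV hV0 hclose => ?_⟩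
  have := h V ⟨hV.contDiffOn, fun x hx => ?_⟩ ?_
  · rwa [aux_Jfun hΩo huU hU, aux_Jfun hΩo (fun x _ => rfl) hV0] at this
  · apply (hV0 x _).1
    rw [hΩo.frontier_eq] at hx; exact hx.2
  · intro x hx
    have he : u =ᶠ[nhds x] U := by
      filter_upwards [hΩo.mem_nhds hx] with z hz using huU z hz
    have := hclose x hx
    rw [huU x hx]
    unfold gradient
    rw [he.fderiv_eq, ← map_sub, LinearIsometryEquiv.norm_map]
    exact this

open Set Metric MeasureTheory Bornology
open scoped RealInnerProductSpace Classical

lemma aux_uc {N : ℕ} {U : EE N → ℝ} (hU : ContDiff ℝ 1 U) (hUc : HasCompactSupport U) :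
    ∀ ε > (0:ℝ), ∃ δ > (0:ℝ), ∀ x y, dist x y < δ →
      |U x - U y| < ε ∧ ‖fderiv ℝ U x - fderiv ℝ U y‖ < ε := by
  intro ε hε
  have h1 := hUc.uniformContinuous_of_continuous hU.continuous
  have h2 := (hUc.fderiv (𝕜 := ℝ)).uniformContinuous_of_continuous (hU.continuous_fderiv (by norm_num))
  obtain ⟨d1, hd1, h1⟩ := Metric.uniformContinuous_iff.1 h1 ε hε
  obtain ⟨d2, hd2, h2⟩ := Metric.uniformContinuous_iff.1 h2 ε hε
  refine ⟨min d1 d2, lt_min hd1 hd2, fun x y hxy => ⟨?_, ?_⟩⟩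
  · rw [← Real.dist_eq]; exact h1 (hxy.trans_le (min_le_left _ _))
  · rw [← dist_eq_norm]; exact h2 (hxy.trans_le (min_le_right _ _))

lemma aux_bd {N : ℕ} {U : EE N → ℝ} (hU : ContDiff ℝ 1 U) (hUc : HasCompactSupport U) :
    ∃ M > (0:ℝ), ∀ x, ‖fderiv ℝ U x‖ ≤ M := by
  obtain ⟨C, hC⟩ := (hU.continuous_fderiv (by norm_num)).bounded_above_of_compact_support
    (hUc.fderiv (𝕜 := ℝ))
  exact ⟨max C 1, by positivity, fun x => (hC x).trans (le_max_left _ _)⟩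

lemma aux_Gp_int {N : ℕ} {g : ℝ → ℝ} (hgc : ContinuousOn g (Ici 0)) {U : EE N → ℝ}
    (hU : ContDiff ℝ 1 U) (hUc : HasCompactSupport U) {c : ℝ} (hc : 0 ≤ c) :
    Integrable (fun x => Gfun g (c * ‖fderiv ℝ U x‖)) :=
  (aux_Gp_cont hgc hU hc).integrable_of_hasCompactSupport (aux_Gp_supp hUc c)

lemma aux_jjU {N : ℕ} {g f : ℝ → ℝ} (hgc : ContinuousOn g (Ici 0)) {U : EE N → ℝ}
    (hU : ContDiff ℝ 1 U) (hUc : HasCompactSupport U) (hF : Integrable (fun x => Gfun f (U x))) :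
    jj g f U = Kfun g U (∫ x, Gfun f (U x)) 1 := by
  unfold jj Kfun
  have h := aux_Gp_int hgc hU hUc (zero_le_one)
  simp only [one_mul] at h
  rw [integral_sub h hF]
  simp

lemma aux_A {N : ℕ} {g f : ℝ → ℝ} (hgc : ContinuousOn g (Ici 0)) {Ω : Set (EE N)}
    {R : ℝ} (hR : 0 < R) (hΩR : ∀ x ∈ Ω, ‖x‖ ≤ R)
    (hstar : ∀ x ∈ Ω, ∀ t ∈ Icc (0:ℝ) 1, t • x ∈ Ω) {U : EE N → ℝ}
    (hU : ContDiff ℝ 1 U) (hUc : HasCompactSupport U) (hF : Integrable (fun x => Gfun f (U x)))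
    (hU0 : ∀ x ∉ Ω, U x = 0 ∧ fderiv ℝ U x = 0)
    (hmin : ∃ ε > (0:ℝ), ∀ V : EE N → ℝ, ContDiff ℝ 1 V →
      (∀ x ∉ Ω, V x = 0 ∧ fderiv ℝ V x = 0) →
      (∀ x ∈ Ω, |V x - U x| + ‖fderiv ℝ V x - fderiv ℝ U x‖ < ε) → jj g f U ≤ jj g f V) :
    ∃ a0 > (0:ℝ), ∀ l, 1 - a0 < l → l < 1 →
      Kfun g U (∫ x, Gfun f (U x)) 1 ≤ Kfun g U (∫ x, Gfun f (U x)) l := by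
  obtain ⟨ε, hε, hmin⟩ := hmin
  obtain ⟨M, hM, hMb⟩ := aux_bd hU hUc
  obtain ⟨δ, hδ, huc⟩ := aux_uc hU hUc (ε/3) (by positivity)
  set a1 := min (δ / R) (ε / (3 * M)) with ha1
  have ha1p : 0 < a1 := by positivity
  refine ⟨min (1/2) (a1/4), by positivity, fun l hl hl1 => ?_⟩
  have hl2 : 1/2 < l := by linarith [min_le_left (1/2) (a1/4)]
  have hl3 : 1 - l < a1/4 := by linarith [min_le_right (1/2) (a1/4)]
  have hlp : 0 < l := by linarith
  set c := l⁻¹ with hc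
  have hc1 : 1 < c := (one_lt_inv₀ hlp).2 hl1
  have hcl : c * l = 1 := inv_mul_cancel₀ hlp.ne'
  have hca : c - 1 < a1 := by nlinarith
  have hd : ∀ x, fderiv ℝ (fun x => U (c • x)) x = c • fderiv ℝ U (c • x) :=
    fun x => fderiv_comp_smul _
  have hjV : jj g f (fun x => U (c • x)) = Kfun g U (∫ x, Gfun f (U x)) l := by
    unfold jj Kfun
    simp only [hd, norm_smul, Real.norm_of_nonneg (by linarith : 0 ≤ c)]
    have := Measure.integral_comp_inv_smul_of_nonneg (volume : Measure (EE N))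
      (fun y => Gfun g (c * ‖fderiv ℝ U y‖) - Gfun f (U y)) hlp.le
    simp only [← hc] at this
    rw [this, integral_sub (aux_Gp_int hgc hU hUc (by linarith)) hF]
    simp [hc]
  rw [← hjV, ← aux_jjU hgc hU hUc hF]
  apply hmin
  · exact hU.comp (contDiff_const_smul c)
  · intro x hx
    have hcx : c • x ∉ Ω := by
      intro h
      have := hstar _ h l ⟨hlp.le, hl1.le⟩
      rw [smul_smul, mul_comm, hcl, one_smul] at this
      exact hx this
    simp only [hd]
    rw [(hU0 _ hcx).1, (hU0 _ hcx).2]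
    simp
  · intro x hx
    have hdist : dist (c • x) x < δ := by
      rw [dist_eq_norm]
      have : c • x - x = (c - 1) • x := by rw [sub_smul, one_smul]
      rw [this, norm_smul, Real.norm_of_nonneg (by linarith)]
      calc (c - 1) * ‖x‖ ≤ (c - 1) * R := by
            apply mul_le_mul_of_nonneg_left (hΩR x hx); linarith
        _ < a1 * R := by gcongr
        _ ≤ δ / R * R := by gcongr; exact min_le_left _ _
        _ = δ := by field_simp
    obtain ⟨h1, h2⟩ := huc _ _ hdist
    rw [hd]
    have h3 : ‖c • fderiv ℝ U (c • x) - fderiv ℝ U x‖ ≤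
        (c - 1) * M + ‖fderiv ℝ U (c • x) - fderiv ℝ U x‖ := by
      have : c • fderiv ℝ U (c • x) - fderiv ℝ U x =
        (c - 1) • fderiv ℝ U (c • x) + (fderiv ℝ U (c • x) - fderiv ℝ U x) := by
        rw [sub_smul, one_smul]; abel
      rw [this]
      refine (norm_add_le _ _).trans ?_
      rw [norm_smul, Real.norm_of_nonneg (by linarith)]
      gcongr
      exact hMb _
    have h4 : (c - 1) * M < ε / 3 := by
      calc (c - 1) * M < a1 * M := by gcongr
        _ ≤ ε / (3 * M) * M := by gcongr; exact min_le_right _ _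
        _ = ε / 3 := by field_simp
    linarith

open Set Metric MeasureTheory Bornology
open scoped RealInnerProductSpace Classical

lemma aux_strip_local {N : ℕ} {Ω : Set (EE N)} (hΩo : IsOpen Ω) (hΩbd : HasC1Boundary Ω)
    {y : EE N} (hy : y ∈ frontier Ω) :
    ∃ r > (0:ℝ), ∃ C > (0:ℝ), ∃ d1 > (0:ℝ), ∀ δ, 0 < δ → δ < d1 →
      volume.real {x | x ∈ Ω ∧ x ∈ ball y r ∧ infDist x Ωᶜ < δ} ≤ C * δ := by
  obtain ⟨V, ρ, hV, hyV, hρ, hΩρ, hgr⟩ := hΩbd y hy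
  have hyc : y ∈ Ωᶜ := by rw [hΩo.frontier_eq] at hy; exact hy.2
  have hst : HasStrictFDerivAt ρ (fderiv ℝ ρ y) y :=
    (hρ.contDiffAt (hV.mem_nhds hyV)).hasStrictFDerivAt (by norm_num)
  set D := fderiv ℝ ρ y with hD
  have hD0 : D ≠ 0 := by
    intro h; apply hgr; unfold gradient; rw [← hD, h, map_zero]
  obtain ⟨e0, he0⟩ : ∃ e, D e ≠ 0 := by
    by_contra! h; exact hD0 (ContinuousLinearMap.ext h)
  set e := (D e0)⁻¹ • e0 with he
  have hDe : D e = 1 := by simp [he, he0]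
  have hen : 0 < ‖e‖ := by
    rw [norm_pos_iff]; intro h; rw [h, map_zero] at hDe; norm_num at hDe
  set c : ℝ := 1 / (2 * ‖e‖) with hc
  have hcp : 0 < c := by positivity
  have hev := (hst.isLittleO.def hcp)
  rw [nhds_prod_eq, Filter.eventually_prod_self_iff'] at hev
  obtain ⟨T, hT, hTe⟩ := hev
  obtain ⟨s, hs, hsT⟩ := Metric.mem_nhds_iff.1 (Filter.inter_mem hT (hV.mem_nhds hyV))
  have hest : ∀ a ∈ ball y s, ∀ b ∈ ball y s, |ρ a - ρ b - D (a - b)| ≤ c * ‖a - b‖ := by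
    intro a ha b hb
    have := hTe a (hsT ha).1 b (hsT hb).1
    simpa using this
  set L := ‖D‖ + c with hL
  have hLp : 0 < L := by positivity
  set W := volume.real (ball y (s + 2 * L * ‖e‖)) with hW
  refine ⟨s/2, by positivity, 2 * W + 1, by positivity, min (s/2) (1/2), by positivity,
    fun δ hδ hδ1 => ?_⟩
  have hδs : δ < s/2 := hδ1.trans_le (min_le_left _ _)
  have hδ2 : δ < 1/2 := hδ1.trans_le (min_le_right _ _)
  set S := {x | x ∈ Ω ∧ x ∈ ball y (s/2) ∧ infDist x Ωᶜ < δ} with hS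
  have hSm : MeasurableSet S := by
    apply IsOpen.measurableSet
    exact hΩo.inter (isOpen_ball.inter (isOpen_lt (continuous_infDist_pt _) continuous_const))
  have hSb : ∀ x ∈ S, -(L * δ) ≤ ρ x ∧ ρ x < 0 := by
    rintro x ⟨hx1, hx2, hx3⟩
    have hxs : x ∈ ball y s := ball_subset_ball (by linarith) hx2
    refine ⟨?_, (hΩρ x (hsT hxs).2).1 hx1⟩
    obtain ⟨z, hz, hxz⟩ := (infDist_lt_iff ⟨y, hyc⟩).1 hx3
    have hzs : z ∈ ball y s := by
      rw [mem_ball] at hx2 ⊢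
      have := dist_triangle z x y
      rw [dist_comm z x] at this
      linarith
    have hρz : 0 ≤ ρ z := by
      by_contra! h; exact hz ((hΩρ z (hsT hzs).2).2 h)
    have h1 := hest x hxs z hzs
    have h2 := (D.le_opNorm (x - z))
    rw [Real.norm_eq_abs] at h2
    have h3 : ‖x - z‖ ≤ δ := by rw [← dist_eq_norm]; exact hxz.le
    have h4 : L * ‖x - z‖ ≤ L * δ := by gcongr
    have := abs_le.1 h1
    have := abs_le.1 h2
    rw [hL] at h4 ⊢
    linarith
  have hsep : ∀ a ∈ S, ∀ b ∈ S, ∀ t : ℝ, 0 < t → a = b + t • e → t < 2 * (L * δ) := by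
    intro a ha b hb t ht hab
    have h1 := hest a (ball_subset_ball (by linarith) ha.2.1) b
      (ball_subset_ball (by linarith) hb.2.1)
    have h2 : a - b = t • e := by rw [hab]; abel
    rw [h2, map_smul, hDe, norm_smul, Real.norm_of_nonneg ht.le] at h1
    have h3 : c * (t * ‖e‖) = t / 2 := by rw [hc]; field_simp
    rw [h3] at h1
    have := (abs_le.1 h1).1
    simp only [smul_eq_mul, mul_one] at this
    linarith [(hSb a ha).2, (hSb b hb).1]
  set n := ⌊1/δ⌋₊ with hn
  have hn1 : (n:ℝ) ≤ 1/δ := Nat.floor_le (by positivity)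
  have hn2 : 1/δ < n + 1 := Nat.lt_floor_add_one _
  have hn3 : 1 ≤ 2 * δ * n := by
    have : 1 < (n+1) * δ := by rwa [div_lt_iff₀ hδ] at hn2
    nlinarith
  set A : ℕ → Set (EE N) := fun k => (fun x => x + (k * (2 * (L * δ))) • e) '' S with hA
  have hAm : ∀ k, MeasurableSet (A k) := by
    intro k
    exact (MeasurableEquiv.addRight ((k * (2 * (L * δ))) • e)).measurableSet_image.2 hSm
  have hAv : ∀ k, volume.real (A k) = volume.real S := by
    intro k
    simp only [hA, measureReal_def]
    rw [image_add_right, measure_preimage_add_right]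
  have hAs : ∀ k < n, A k ⊆ ball y (s + 2 * L * ‖e‖) := by
    rintro k hk _ ⟨x, hx, rfl⟩
    have hx2 := hx.2.1
    rw [mem_ball, dist_eq_norm] at hx2 ⊢
    have h1 : x + (k * (2 * (L * δ))) • e - y = (x - y) + (k * (2 * (L * δ))) • e := by abel
    rw [h1]
    refine (norm_add_le _ _).trans_lt ?_
    rw [norm_smul, Real.norm_of_nonneg (by positivity)]
    have hkn : (k:ℝ) ≤ n := by exact_mod_cast hk.le
    have h2 : (k:ℝ) * δ ≤ 1 := by
      have := hkn.trans hn1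
      rwa [le_div_iff₀ hδ] at this
    have : (k * (2 * (L * δ))) * ‖e‖ ≤ 2 * L * ‖e‖ := by
      calc (k * (2 * (L * δ))) * ‖e‖ = (2 * L * ‖e‖) * (k * δ) := by ring
        _ ≤ (2 * L * ‖e‖) * 1 := by gcongr
        _ = _ := by ring
    linarith
  have hdisj : ∀ i j : ℕ, i < j → Disjoint (A i) (A j) := by
    intro i j hij
    rw [Set.disjoint_left]
    rintro _ ⟨a, ha, rfl⟩ ⟨b, hb, hab⟩
    simp only at hab
    have hij' : (i:ℝ) + 1 ≤ j := by exact_mod_cast hij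
    have := hsep a ha b hb ((j - i) * (2 * (L * δ)))
      (by have : (0:ℝ) < j - i := by linarith
          positivity) (by
        rw [sub_mul, sub_smul, ← add_sub_assoc, hab]; abel)
    nlinarith [mul_pos hLp hδ]
  have hsum : ∑ k ∈ Finset.range n, volume.real (A k) ≤ W := by
    rw [← measureReal_biUnion_finset (h := fun k hk =>
      ((measure_mono (hAs k (Finset.mem_range.1 hk))).trans_lt measure_ball_lt_top).ne)]
    · apply measureReal_mono _ measure_ball_lt_top.ne
      intro x hx
      simp only [mem_iUnion, Finset.mem_range] at hx
      obtain ⟨k, hk, hx⟩ := hx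
      exact hAs k hk hx
    · intro i _ j _ hij
      rcases lt_or_gt_of_ne hij with h | h
      · exact hdisj i j h
      · exact (hdisj j i h).symm
    · intro k _; exact hAm k
  simp only [hAv, Finset.sum_const, Finset.card_range, nsmul_eq_mul] at hsum
  have hSn : 0 ≤ volume.real S := measureReal_nonneg
  calc volume.real S ≤ (2 * δ * n) * volume.real S := by nlinarith
    _ = 2 * δ * (n * volume.real S) := by ring
    _ ≤ 2 * δ * W := by gcongr
    _ ≤ (2 * W + 1) * δ := by linarith

lemma aux_strip {N : ℕ} {Ω : Set (EE N)} (hΩo : IsOpen Ω) (hΩb : IsBounded Ω)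
    (hΩbd : HasC1Boundary Ω) (hne : Ωᶜ.Nonempty) :
    ∃ C > (0:ℝ), ∃ d1 > (0:ℝ), ∀ δ, 0 < δ → δ < d1 →
      volume.real {x | x ∈ Ω ∧ infDist x Ωᶜ < δ} ≤ C * δ := by
  have hcomp : IsCompact (frontier Ω) :=
    Metric.isCompact_of_isClosed_isBounded isClosed_frontier
      (hΩb.closure.subset frontier_subset_closure)
  have hloc : ∀ y : EE N, ∃ r > (0:ℝ), ∃ C > (0:ℝ), ∃ d1 > (0:ℝ), y ∈ frontier Ω → 
      ∀ δ, 0 < δ → δ < d1 →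
      volume.real {x | x ∈ Ω ∧ x ∈ ball y r ∧ infDist x Ωᶜ < δ} ≤ C * δ := by
    intro y
    by_cases hy : y ∈ frontier Ω
    · obtain ⟨r, hr, C, hC, d, hd, h⟩ := aux_strip_local hΩo hΩbd hy
      exact ⟨r, hr, C, hC, d, hd, fun _ => h⟩
    · exact ⟨1, one_pos, 1, one_pos, 1, one_pos, fun h => absurd h hy⟩
  choose r hr C hC d hd h using hloc
  obtain ⟨t, ht, htc⟩ := hcomp.elim_nhds_subcover (fun y => ball y (r y))
    (fun y _ => ball_mem_nhds y (hr y))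
  have hopen : IsOpen (⋃ y ∈ t, ball y (r y)) := isOpen_biUnion fun _ _ => isOpen_ball
  obtain ⟨d0, hd0, hth⟩ := hcomp.exists_thickening_subset_open hopen htc
  have hdt : ∃ d2 > (0:ℝ), ∀ y ∈ t, d2 ≤ d y := by
    clear ht htc hopen hth
    induction t using Finset.induction_on with
    | empty => exact ⟨1, one_pos, by simp⟩
    | insert a s _ ih =>
      obtain ⟨d2, h2, h3⟩ := ih
      refine ⟨min d2 (d a), lt_min h2 (hd a), ?_⟩
      intro y hy
      rcases Finset.mem_insert.1 hy with rfl | hy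
      · exact min_le_right _ _
      · exact (min_le_left _ _).trans (h3 y hy)
  obtain ⟨d2, hd2, hd2'⟩ := hdt
  refine ⟨(∑ y ∈ t, C y) + 1, by
    have : 0 ≤ ∑ y ∈ t, C y := Finset.sum_nonneg fun y _ => (hC y).le
    linarith, min d0 d2, lt_min hd0 hd2, fun δ hδ hδ1 => ?_⟩
  have hδ0 : δ < d0 := hδ1.trans_le (min_le_left _ _)
  have hδ2 : δ < d2 := hδ1.trans_le (min_le_right _ _)
  have hsub : {x | x ∈ Ω ∧ infDist x Ωᶜ < δ} ⊆
      ⋃ y ∈ t, {x | x ∈ Ω ∧ x ∈ ball y (r y) ∧ infDist x Ωᶜ < δ} := by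
    rintro x ⟨hx, hxd⟩
    obtain ⟨z, hz, hzx⟩ : ∃ z ∈ frontier Ω, dist x z < δ := by
      obtain ⟨z, hz, hxz⟩ := hΩo.isClosed_compl.exists_infDist_eq_dist hne x
      refine ⟨z, ?_, hxz ▸ hxd⟩
      rw [hΩo.frontier_eq]
      refine ⟨?_, hz⟩
      have hd : dist x z ≠ 0 := by
        rw [dist_ne_zero]; rintro rfl; exact hz hx
      have hcl : closure (ball x (dist x z)) = closedBall x (dist x z) := closure_ball x hd
      have hzc : z ∈ closure (ball x (dist x z)) := by
        rw [hcl, mem_closedBall, dist_comm]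
      refine closure_mono ?_ hzc
      intro w hw
      by_contra hwΩ
      have h1 : infDist x Ωᶜ ≤ dist x w := infDist_le_dist_of_mem hwΩ
      rw [mem_ball, dist_comm] at hw
      linarith
    have hx' : x ∈ Metric.thickening d0 (frontier Ω) :=
      Metric.mem_thickening_iff.2 ⟨z, hz, hzx.trans hδ0⟩
    have := hth hx'
    simp only [mem_iUnion] at this ⊢
    obtain ⟨y, hy, hxy⟩ := this
    exact ⟨y, hy, hx, hxy, hxd⟩
  have hfin : ∀ y, volume {x | x ∈ Ω ∧ x ∈ ball y (r y) ∧ infDist x Ωᶜ < δ} ≠ ⊤ := fun y =>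
    ((measure_mono (fun x hx => hx.2.1)).trans_lt (measure_ball_lt_top (x := y) (r := r y))).ne
  calc _ ≤ volume.real (⋃ y ∈ t, {x | x ∈ Ω ∧ x ∈ ball y (r y) ∧ infDist x Ωᶜ < δ}) := by
        refine measureReal_mono hsub ?_
        exact ((measure_biUnion_finset_le t _).trans_lt 
          (ENNReal.sum_lt_top.2 fun y _ => (hfin y).lt_top)).ne
    _ ≤ ∑ y ∈ t, volume.real {x | x ∈ Ω ∧ x ∈ ball y (r y) ∧ infDist x Ωᶜ < δ} :=
        measureReal_biUnion_finset_le t _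
    _ ≤ ∑ y ∈ t, C y * δ := by
        apply Finset.sum_le_sum
        intro y hy
        exact h y (ht y hy) δ hδ (hδ2.trans_le (hd2' y hy))
    _ = (∑ y ∈ t, C y) * δ := by rw [Finset.sum_mul]
    _ ≤ _ := by nlinarith

open Set Metric MeasureTheory Bornology
open scoped RealInnerProductSpace Classical Convolution

lemma aux_cutoff {N : ℕ} (A : Set (EE N)) {δ : ℝ} (hδ : 0 < δ) :
    ∃ η : EE N → ℝ, ContDiff ℝ 1 η ∧ (∀ x, 0 ≤ η x) ∧ (∀ x, η x ≤ 1) ∧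
      (∀ x, infDist x A ≤ δ → η x = 0) ∧ (∀ x, 3 * δ ≤ infDist x A → η x = 1) ∧
      (∀ x, ‖fderiv ℝ η x‖ ≤ 1 / δ) := by
  set w : EE N → ℝ := fun x => max 0 (min 1 ((infDist x A - 3/2 * δ) / δ)) with hw
  have hwc : Continuous w := by
    have := continuous_infDist_pt A
    fun_prop
  have hw0 : ∀ x, 0 ≤ w x := fun x => le_max_left _ _
  have hw1 : ∀ x, w x ≤ 1 := fun x => max_le zero_le_one (min_le_left _ _)
  have hwl : ∀ x y, |w x - w y| ≤ 1 / δ * dist x y := by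
    intro x y
    simp only [hw]
    refine (abs_max_sub_max_le_max _ _ _ _).trans ?_
    refine max_le (by simp; positivity) ?_
    refine (abs_min_sub_min_le_max _ _ _ _).trans ?_
    refine max_le (by simp; positivity) ?_
    have h1 : infDist x A ≤ infDist y A + dist x y := infDist_le_infDist_add_dist
    have h2 : infDist y A ≤ infDist x A + dist y x := infDist_le_infDist_add_dist
    rw [dist_comm y x] at h2
    have h3 : (infDist x A - 3/2 * δ) / δ - (infDist y A - 3/2 * δ) / δ =
      1/δ * (infDist x A - infDist y A) := by field_simp; ring
    rw [h3, abs_mul, abs_of_pos (by positivity : 0 < 1/δ)]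
    apply mul_le_mul_of_nonneg_left _ (by positivity)
    rw [abs_le]; constructor <;> linarith
  set φ : ContDiffBump (0 : EE N) := ⟨δ/4, δ/2, by positivity, by linarith⟩ with hφ
  set k : EE N → ℝ := φ.normed volume with hk
  have hkc : Continuous k := φ.continuous_normed
  have hks : HasCompactSupport k := φ.hasCompactSupport_normed
  have hki : ∫ x, k x = 1 := φ.integral_normed
  have hk0 : ∀ x, 0 ≤ k x := φ.nonneg_normed
  set η : EE N → ℝ := k ⋆[ContinuousLinearMap.lsmul ℝ ℝ, volume] w with hη
  have hηx : ∀ x, η x = ∫ t, k t * w (x - t) := fun x => rfl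
  have hIntg0 : ∀ x, Integrable (fun t => k t * w (x - t)) := fun x =>
    Continuous.integrable_of_hasCompactSupport (by fun_prop) hks.mul_right
  have hkint : Integrable k := hkc.integrable_of_hasCompactSupport hks
  refine ⟨η, ?_, ?_, ?_, ?_, ?_, ?_⟩
  · exact hks.contDiff_convolution_left _ φ.contDiff_normed hwc.locallyIntegrable
  · intro x; rw [hηx]
    exact integral_nonneg fun t => mul_nonneg (hk0 t) (hw0 _)
  · intro x; rw [hηx, ← hki]
    apply integral_mono (hIntg0 x) hkint
    intro t
    exact mul_le_of_le_one_right (hk0 t) (hw1 _)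
  · intro x hx
    have hz : ∀ y ∈ ball x φ.rOut, w y = 0 := by
      intro y hy
      have h1 : infDist y A ≤ infDist x A + dist y x := infDist_le_infDist_add_dist
      have h2 : dist y x < δ / 2 := hy
      simp only [hw]
      apply max_eq_left
      refine (min_le_right _ _).trans ?_
      apply div_nonpos_of_nonpos_of_nonneg _ hδ.le
      linarith
    have hz0 := hz x (mem_ball_self φ.rOut_pos)
    rw [← hz0]
    exact φ.normed_convolution_eq_right (μ := volume) (fun y hy => by rw [hz y hy, hz0])
  · intro x hx
    have hz : ∀ y ∈ ball x φ.rOut, w y = 1 := by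
      intro y hy
      have h1 : infDist x A ≤ infDist y A + dist x y := infDist_le_infDist_add_dist
      have h2 : dist y x < δ / 2 := hy
      rw [dist_comm] at h2
      simp only [hw]
      rw [min_eq_left, max_eq_right zero_le_one]
      rw [le_div_iff₀ hδ]
      linarith
    have hz0 := hz x (mem_ball_self φ.rOut_pos)
    rw [← hz0]
    exact φ.normed_convolution_eq_right (μ := volume) (fun y hy => by rw [hz y hy, hz0])
  · intro x
    have hl : LipschitzWith (Real.toNNReal (1/δ)) η := by
      apply LipschitzWith.of_dist_le_mul
      intro x y
      rw [Real.coe_toNNReal _ (by positivity), dist_eq_norm, hηx, hηx, 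
        ← integral_sub (hIntg0 x) (hIntg0 y)]
      have : 1/δ * dist x y = ∫ t, k t * (1/δ * dist x y) := by
        rw [integral_mul_const, hki, one_mul]
      rw [this]
      apply norm_integral_le_of_norm_le (hkint.mul_const _)
      refine Filter.Eventually.of_forall fun t => ?_
      rw [← mul_sub, norm_mul, Real.norm_of_nonneg (hk0 t), Real.norm_eq_abs]
      apply mul_le_mul_of_nonneg_left _ (hk0 t)
      have := hwl (x - t) (y - t)
      rwa [dist_sub_right] at this
    have := norm_fderiv_le_of_lipschitz ℝ hl (x₀ := x)
    rwa [Real.coe_toNNReal _ (by positivity)] at this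

open Set Metric MeasureTheory Bornology
open scoped RealInnerProductSpace Classical

lemma aux_diffeo {N : ℕ} {k : EE N → EE N} (hk : ContDiff ℝ 1 k)
    (hk2 : ∀ y, ‖fderiv ℝ k y‖ ≤ 1/2) :
    ∃ Ψ : EE N ≃ₜ EE N, (∀ y, Ψ y = y + k y) ∧ ContDiff ℝ 1 Ψ.symm ∧
      ∀ y, HasFDerivAt Ψ (1 + fderiv ℝ k y) y := by
  have hlip : LipschitzWith (1/2 : NNReal) k := by
    apply lipschitzWith_of_nnnorm_fderiv_le (𝕜 := ℝ) (hk.differentiable (by norm_num))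
    intro x
    rw [← NNReal.coe_le_coe]; simpa using hk2 x
  have happ : ApproximatesLinearOn (fun y => y + k y)
      ((ContinuousLinearEquiv.refl ℝ (EE N) : EE N ≃L[ℝ] EE N) : EE N →L[ℝ] EE N) univ 
      (1/2 : NNReal) := by
    intro x _ y _
    have := hlip.dist_le_mul x y
    rw [dist_eq_norm, dist_eq_norm] at this
    have e1 : x + k x - (y + k y) - (x - y) = k x - k y := by abel
    change ‖x + k x - (y + k y) - (x - y)‖ ≤ _
    rw [e1]; exact this
  have hc : Subsingleton (EE N) ∨ (1/2 : NNReal) <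
      ‖((ContinuousLinearEquiv.refl ℝ (EE N)).symm : EE N →L[ℝ] EE N)‖₊⁻¹ := by
    rcases subsingleton_or_nontrivial (EE N) with h | h
    · exact Or.inl h
    · right
      have : ‖((ContinuousLinearEquiv.refl ℝ (EE N)).symm : EE N →L[ℝ] EE N)‖₊ = 1 := by
        simp
      rw [this, inv_one]
      exact NNReal.half_lt_self one_ne_zero
  set Ψ := happ.toHomeomorph _ hc with hΨ
  have hΨy : ∀ y, Ψ y = y + k y := fun y => rfl
  have hΨf : (Ψ : EE N → EE N) = fun y => y + k y := funext hΨy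
  have hd : ∀ y, HasFDerivAt Ψ (1 + fderiv ℝ k y) y := by
    intro y
    rw [hΨf]
    exact (hasFDerivAt_id y).add (hk.differentiable (by norm_num) y).hasFDerivAt
  have hlt : ∀ y, ‖-fderiv ℝ k y‖ < 1 := fun y => by
    rw [norm_neg]; linarith [hk2 y]
  refine ⟨Ψ, hΨy, ?_, hd⟩
  refine Homeomorph.contDiff_symm Ψ
    (f₀' := fun y => ContinuousLinearEquiv.ofUnit (Units.oneSub _ (hlt y))) ?_ ?_
  · intro y
    have : ((ContinuousLinearEquiv.ofUnit (Units.oneSub _ (hlt y)) : EE N ≃L[ℝ] EE N) :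
        EE N →L[ℝ] EE N) = 1 + fderiv ℝ k y := by
      have h1 : ((ContinuousLinearEquiv.ofUnit (Units.oneSub _ (hlt y)) : EE N ≃L[ℝ] EE N) :
        EE N →L[ℝ] EE N) = (Units.oneSub _ (hlt y)).val := rfl
      rw [h1, Units.val_oneSub, sub_neg_eq_add]
    rw [this]; exact hd y
  · rw [hΨf]; exact contDiff_id.add hk

lemma aux_det {N : ℕ} {l : ℝ} (hl : l ≠ 0) (a : EE N →L[ℝ] ℝ) (y : EE N) :
    (l • (1 : EE N →L[ℝ] EE N) + a.smulRight y).det = l ^ N * (1 + l⁻¹ * a y) := by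
  have h : ((l • (1 : EE N →L[ℝ] EE N) + a.smulRight y : EE N →L[ℝ] EE N) : EE N →ₗ[ℝ] EE N) =
      l • LinearMap.transvection ((l⁻¹ • a : EE N →L[ℝ] ℝ) : EE N →ₗ[ℝ] ℝ) y := by
    ext1 v
    simp [LinearMap.transvection.apply, smul_smul, hl]
  unfold ContinuousLinearMap.det
  rw [h, LinearMap.det_smul, LinearMap.transvection.det]
  simp

/-- the bound on the Jacobian -/
lemma aux_detbd {N : ℕ} (hN : 1 ≤ N) {e h b : ℝ} (he : 0 < e) (he1 : e ≤ 1) (hh0 : 0 ≤ h)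
    (hh1 : h ≤ 1) :
    |(|(1 + e * h) ^ N * (1 + (1 + e * h)⁻¹ * (e * b))|) - (1 + e) ^ N| ≤
      2 ^ N * (e * (1 + |b|)) := by
  have hl : 0 < 1 + e * h := by positivity
  obtain ⟨n, rfl⟩ : ∃ n, N = n + 1 := ⟨N - 1, by omega⟩
  have h1 : (1 + e * h) ^ (n+1) * (1 + (1 + e * h)⁻¹ * (e * b)) =
      (1 + e * h) ^ (n+1) + (1 + e * h) ^ n * (e * b) := by
    rw [pow_succ]; field_simp
  have hle : 1 + e * h ≤ 1 + e := by nlinarith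
  have hle2 : 1 + e * h ≤ 2 := by linarith
  have hbern : ∀ m : ℕ, (1 + e) ^ m ≤ 1 + (2 ^ m - 1) * e := by
    intro m
    induction m with
    | zero => simp
    | succ m ih =>
      have h2 : (1:ℝ) ≤ 2 ^ m := one_le_pow₀ (by norm_num)
      calc (1 + e) ^ (m+1) = (1+e)^m * (1 + e) := pow_succ _ _
        _ ≤ (1 + (2 ^ m - 1) * e) * (1 + e) := by gcongr
        _ ≤ 1 + (2 ^ (m+1) - 1) * e := by
          rw [pow_succ]
          nlinarith [mul_nonneg (sub_nonneg.2 h2) (mul_nonneg he.le (sub_nonneg.2 he1))]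
  rw [h1]
  have habs : |(1 + e) ^ (n+1)| = (1+e)^(n+1) := abs_of_pos (by positivity)
  rw [← habs]
  refine (abs_abs_sub_abs_le _ _).trans ?_
  have h3 : (1 + e * h) ^ (n+1) ≤ (1 + e) ^ (n+1) := by gcongr
  have h4 : 1 ≤ (1 + e * h) ^ (n+1) := one_le_pow₀ (by nlinarith)
  have h5 : |(1 + e * h) ^ n * (e * b)| ≤ 2 ^ (n+1) * (e * |b|) := by
    rw [abs_mul, abs_mul, abs_of_pos he, abs_of_pos (by positivity)]
    gcongr ?_ * _
    calc (1 + e * h) ^ n ≤ 2 ^ n := by gcongr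
      _ ≤ 2 ^ (n+1) := by gcongr <;> norm_num
  have h6 := hbern (n+1)
  have h7 := abs_le.1 h5
  rw [abs_le]
  constructor <;> nlinarith

open Set Metric MeasureTheory Bornology
open scoped RealInnerProductSpace Classical

lemma aux_pt {N : ℕ} {g : ℝ → ℝ} (hgc : ContinuousOn g (Ici 0))
    (hgm : StrictMonoOn g (Ici 0)) (hg0 : g 0 = 0) {p q e κ d Φ : ℝ} (hp : 0 ≤ p) (hq : 0 ≤ q)
    (he : 0 < e) (hκ : 1 ≤ κ) (heκ : e * κ ≤ 1/2) (hpq : |q - p| ≤ 2 * (e * κ) * p)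
    (hd : |d - (1+e)^N| ≤ 2^N * (e * κ)) :
    |d * (Gfun g q - Φ) - (1+e)^N * (Gfun g ((1+e)⁻¹ * p) - Φ)| ≤
      8 * 2^N * (e * κ) * (g (2*p) * p + |Gfun g p - Φ|) := by
  have heκ' : e ≤ e * κ := by nlinarith
  have he1 : e ≤ 1/2 := by linarith
  set l := (1+e)^N with hl
  have hlp : 0 < l := by positivity
  have hl2 : l ≤ 2^N := by rw [hl]; gcongr; linarith
  set T : ℝ := 2^N with hT
  have hTp : 0 < T := by positivity
  have hd' := abs_le.1 hd
  have hdu : |d| ≤ 2 * T := by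
    rw [abs_le]; constructor <;> nlinarith
  have hg2 : 0 ≤ g (2*p) := aux_gnn hgm hg0 (by positivity)
  have hmono : MonotoneOn g (Ici 0) := hgm.monotoneOn
  have hq2 : q ≤ 2 * p := by
    have := (abs_le.1 hpq).2
    nlinarith
  have h1 : |Gfun g q - Gfun g p| ≤ g (2*p) * |q - p| := by
    rcases le_total p q with h | h
    · have h2 := aux_Gbound hgc hgm hp h
      have h3 := aux_Gmono hgc hgm hg0 hp h
      rw [abs_of_nonneg (by linarith), abs_of_nonneg (by linarith)]
      refine h2.trans ?_
      apply mul_le_mul_of_nonneg_right _ (by linarith)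
      exact hmono hq (by simp; linarith) hq2
    · have h2 := aux_Gbound hgc hgm hq h
      have h3 := aux_Gmono hgc hgm hg0 hq h
      rw [abs_sub_comm, abs_sub_comm q p, abs_of_nonneg (by linarith), abs_of_nonneg (by linarith)]
      refine h2.trans ?_
      apply mul_le_mul_of_nonneg_right _ (by linarith)
      exact hmono hp (by simp; linarith) (by linarith)
  have h4 : |Gfun g p - Gfun g ((1+e)⁻¹ * p)| ≤ g (2*p) * (e * κ * p) := by
    have ha : 0 ≤ (1+e)⁻¹ * p := by positivity
    have hab : (1+e)⁻¹ * p ≤ p := by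
      apply mul_le_of_le_one_left hp
      apply inv_le_one_of_one_le₀; linarith
    have h2 := aux_Gbound hgc hgm ha hab
    have h3 := aux_Gmono hgc hgm hg0 ha hab
    rw [abs_of_nonneg (by linarith)]
    refine h2.trans ?_
    have h5 : p - (1+e)⁻¹ * p ≤ e * κ * p := by
      have : 1 - (1+e)⁻¹ ≤ e := by
        have : 1 - (1+e)⁻¹ = e / (1+e) := by field_simp; ring
        rw [this]; apply div_le_self he.le; linarith
      nlinarith
    apply mul_le_mul _ h5 (by linarith) hg2
    exact hmono hp (by simp; linarith) (by linarith)
  have h6 : d * (Gfun g q - Φ) - l * (Gfun g ((1+e)⁻¹ * p) - Φ) =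
      d * (Gfun g q - Gfun g p) + (d - l) * (Gfun g p - Φ) +
        l * (Gfun g p - Gfun g ((1+e)⁻¹ * p)) := by ring
  rw [h6]
  refine (abs_add_three _ _ _).trans ?_
  rw [abs_mul, abs_mul, abs_mul, abs_of_pos hlp]
  have b1 : |d| * |Gfun g q - Gfun g p| ≤ 2 * T * (g (2*p) * (2 * (e * κ) * p)) := by
    gcongr
    exact h1.trans (by gcongr)
  have b2 : |d - l| * |Gfun g p - Φ| ≤ T * (e * κ) * |Gfun g p - Φ| := by gcongr
  have b3 : l * |Gfun g p - Gfun g ((1+e)⁻¹ * p)| ≤ T * (g (2*p) * (e * κ * p)) := by gcongr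
  have c1 : 0 ≤ T * (e * κ) * (g (2*p) * p) := by positivity
  have c2 : 0 ≤ T * (e * κ) * |Gfun g p - Φ| := by positivity
  nlinarith

lemma aux_B1 {N : ℕ} (hN : 1 ≤ N) {g f : ℝ → ℝ} (hgc : ContinuousOn g (Ici 0))
    (hgm : StrictMonoOn g (Ici 0)) (hg0 : g 0 = 0) {Ω : Set (EE N)}
    {R : ℝ} (hR : 0 < R) (hΩR : ∀ x ∈ Ω, ‖x‖ ≤ R) {U : EE N → ℝ}
    (hU : ContDiff ℝ 1 U) (hUc : HasCompactSupport U) (hF : Integrable (fun x => Gfun f (U x)))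
    (hU0 : ∀ x ∉ Ω, U x = 0 ∧ fderiv ℝ U x = 0)
    (hmin : ∃ ε > (0:ℝ), ∀ V : EE N → ℝ, ContDiff ℝ 1 V →
      (∀ x ∉ Ω, V x = 0 ∧ fderiv ℝ V x = 0) →
      (∀ x ∈ Ω, |V x - U x| + ‖fderiv ℝ V x - fderiv ℝ U x‖ < ε) → jj g f U ≤ jj g f V)
    {δ m : ℝ} (hδ : 0 < δ) (hm : ∀ y ∈ Ω, infDist y Ωᶜ < 4 * δ →
      g (2 * ‖fderiv ℝ U y‖) * ‖fderiv ℝ U y‖ + |Gfun g ‖fderiv ℝ U y‖ - Gfun f (U y)| ≤ m) :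
    ∃ e0 > (0:ℝ), ∀ e, 0 < e → e < e0 →
      Kfun g U (∫ x, Gfun f (U x)) 1 ≤ Kfun g U (∫ x, Gfun f (U x)) (1 + e) +
        8 * 2^N * (e * (1 + R/δ)) * m * volume.real {x | x ∈ Ω ∧ infDist x Ωᶜ < 4 * δ} := by
  obtain ⟨ε, hε, hmin⟩ := hmin
  obtain ⟨M, hM, hMb⟩ := aux_bd hU hUc
  obtain ⟨δ', hδ', huc⟩ := aux_uc hU hUc (ε/3) (by positivity)
  obtain ⟨η, hη, hη0, hη1, hηz, hηo, hηd⟩ := aux_cutoff Ωᶜ hδ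
  set κ := 1 + R/δ with hκ
  have hκ1 : 1 ≤ κ := by rw [hκ]; have : 0 < R/δ := by positivity
                         linarith
  have hκp : 0 < κ := by linarith
  refine ⟨min (1/(2*κ)) (min (δ'/R) (ε/(6*κ*M))), by positivity, fun e he hee => ?_⟩
  have hee1 : e < 1/(2*κ) := hee.trans_le (min_le_left _ _)
  have hee2 : e < δ'/R := hee.trans_le ((min_le_right _ _).trans (min_le_left _ _))
  have hee3 : e < ε/(6*κ*M) := hee.trans_le ((min_le_right _ _).trans (min_le_right _ _))
  have heκ : e * κ ≤ 1/2 := by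
    rw [lt_div_iff₀ (by positivity)] at hee1; linarith
  have heR : e * R < δ' := by rwa [lt_div_iff₀ hR] at hee2
  have heM : 2 * (e * κ) * M < ε/3 := by
    rw [lt_div_iff₀ (by positivity)] at hee3; linarith
  have he1 : e ≤ 1 := by nlinarith
  -- facts about the cutoff
  have hηΩ : ∀ y ∉ Ω, η y = 0 := fun y hy => hηz y (by
    rw [infDist_zero_of_mem (show y ∈ Ωᶜ from hy)]; exact hδ.le)
  have hDηΩ : ∀ y ∉ Ω, fderiv ℝ η y = 0 := by
    intro y hy
    have : η =ᶠ[nhds y] fun _ => 0 := by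
      have ho : IsOpen {z | infDist z Ωᶜ < δ} := isOpen_lt (continuous_infDist_pt _) continuous_const
      filter_upwards [ho.mem_nhds (show infDist y Ωᶜ < δ by
        rw [infDist_zero_of_mem (show y ∈ Ωᶜ from hy)]; exact hδ)] with z hz
      exact hηz z (le_of_lt hz)
    rw [this.fderiv_eq]; simp
  have hDηi : ∀ y, 3 * δ < infDist y Ωᶜ → fderiv ℝ η y = 0 := by
    intro y hy
    have : η =ᶠ[nhds y] fun _ => 1 := by
      have ho : IsOpen {z | 3 * δ < infDist z Ωᶜ} :=
        isOpen_lt continuous_const (continuous_infDist_pt _)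
      filter_upwards [ho.mem_nhds hy] with z hz
      exact hηo z (le_of_lt hz)
    rw [this.fderiv_eq]; simp
  have hDηb : ∀ y, ‖fderiv ℝ η y‖ * ‖y‖ ≤ R/δ := by
    intro y
    by_cases hy : y ∈ Ω
    · calc ‖fderiv ℝ η y‖ * ‖y‖ ≤ 1/δ * R := by gcongr; exacts [hηd y, hΩR y hy]
        _ = R/δ := by ring
    · rw [hDηΩ y hy, norm_zero, zero_mul]; positivity
  set k : EE N → EE N := fun y => e • (η y • y) with hk
  have hkc : ContDiff ℝ 1 k := by simp only [hk]; fun_prop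
  have hkd : ∀ y, fderiv ℝ k y = e • (η y • (1 : EE N →L[ℝ] EE N) + (fderiv ℝ η y).smulRight y) := by
    intro y
    have h1 : HasFDerivAt η (fderiv ℝ η y) y := (hη.differentiable (by norm_num) y).hasFDerivAt
    exact ((h1.smul (hasFDerivAt_id y)).const_smul e).fderiv
  have hkn : ∀ y, ‖fderiv ℝ k y‖ ≤ e * κ := by
    intro y
    rw [hkd, norm_smul, Real.norm_of_nonneg he.le]
    gcongr
    refine (norm_add_le _ _).trans ?_
    rw [norm_smul, ContinuousLinearMap.norm_smulRight_apply, Real.norm_of_nonneg (hη0 y), hκ]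
    have h1 : ‖(1 : EE N →L[ℝ] EE N)‖ ≤ 1 := ContinuousLinearMap.norm_id_le
    have h2 : η y * ‖(1 : EE N →L[ℝ] EE N)‖ ≤ 1 := mul_le_one₀ (hη1 y) (norm_nonneg _) h1
    linarith [hDηb y]
  obtain ⟨Ψ, hΨ, hΨs, hΨd⟩ := aux_diffeo hkc (fun y => (hkn y).trans heκ)
  have hΨΩ : ∀ y ∉ Ω, Ψ y = y := by
    intro y hy; rw [hΨ]; simp [hk, hηΩ y hy]
  set V : EE N → ℝ := fun x => U (Ψ.symm x) with hV
  have hVc : ContDiff ℝ 1 V := hU.comp hΨs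
  have hVΨ : ∀ y, V (Ψ y) = U y := fun y => by simp [hV]
  set L : EE N → (EE N →L[ℝ] ℝ) := fun y => fderiv ℝ V (Ψ y) with hL
  have hUL : ∀ y, fderiv ℝ U y = L y + (L y).comp (fderiv ℝ k y) := by
    intro y
    have h1 : HasFDerivAt V (L y) (Ψ y) := (hVc.differentiable (by norm_num) _).hasFDerivAt
    have h2 := h1.comp y (hΨd y)
    have h3 : V ∘ Ψ = U := funext hVΨ
    rw [h3] at h2
    rw [h2.fderiv]
    ext v; simp
  have hLA : ∀ y, ‖(L y).comp (fderiv ℝ k y)‖ ≤ ‖L y‖ * (e * κ) := fun y =>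
    (ContinuousLinearMap.opNorm_comp_le _ _).trans (by gcongr; exact hkn y)
  have hL2 : ∀ y, ‖L y‖ ≤ 2 * ‖fderiv ℝ U y‖ := by
    intro y
    have h1 : L y = fderiv ℝ U y - (L y).comp (fderiv ℝ k y) := by
      rw [hUL y]; abel
    have h2 : ‖L y‖ ≤ ‖fderiv ℝ U y‖ + ‖(L y).comp (fderiv ℝ k y)‖ := by
      conv_lhs => rw [h1]
      exact norm_sub_le _ _
    nlinarith [hLA y, norm_nonneg (L y)]
  have hLd : ∀ y, ‖L y - fderiv ℝ U y‖ ≤ 2 * (e * κ) * ‖fderiv ℝ U y‖ := by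
    intro y
    have h1 : L y - fderiv ℝ U y = - (L y).comp (fderiv ℝ k y) := by
      rw [hUL y]; abel
    rw [h1, norm_neg]
    have : ‖L y‖ * (e * κ) ≤ 2 * ‖fderiv ℝ U y‖ * (e * κ) := by gcongr; exact hL2 y
    linarith [hLA y]
  have hV0 : ∀ x ∉ Ω, V x = 0 ∧ fderiv ℝ V x = 0 := by
    intro x hx
    have h1 := hVΨ x
    have h2 := hL2 x
    simp only [hL] at h2
    rw [hΨΩ x hx] at h1 h2
    rw [h1]
    refine ⟨(hU0 x hx).1, ?_⟩
    rw [(hU0 x hx).2, norm_zero, mul_zero] at h2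
    exact norm_le_zero_iff.1 h2
  have hclose : ∀ x ∈ Ω, |V x - U x| + ‖fderiv ℝ V x - fderiv ℝ U x‖ < ε := by
    intro x hx
    obtain ⟨y, rfl⟩ := Ψ.surjective x
    rw [hVΨ]
    have hd : dist y (Ψ y) < δ' := by
      rw [hΨ, dist_self_add_right]
      simp only [hk]
      by_cases hy : y ∈ Ω
      · rw [norm_smul, norm_smul, Real.norm_of_nonneg he.le, Real.norm_of_nonneg (hη0 y)]
        refine lt_of_le_of_lt ?_ heR
        gcongr
        calc η y * ‖y‖ ≤ 1 * R := by gcongr; exacts [hη1 y, hΩR y hy]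
          _ = R := one_mul R
      · rw [hηΩ y hy]; simpa using hδ'
    obtain ⟨h1, h2⟩ := huc _ _ hd
    have h3 := hLd y
    have h4 : 2 * (e * κ) * ‖fderiv ℝ U y‖ ≤ 2 * (e * κ) * M := by gcongr; exact hMb y
    have h5 : ‖fderiv ℝ V (Ψ y) - fderiv ℝ U (Ψ y)‖ ≤
        ‖L y - fderiv ℝ U y‖ + ‖fderiv ℝ U y - fderiv ℝ U (Ψ y)‖ := norm_sub_le_norm_sub_add_norm_sub _ _ _
    linarith
  have hJ := hmin V hVc hV0 hclose
  rw [aux_jjU hgc hU hUc hF] at hJ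
  -- change of variables
  set dd : EE N → ℝ := fun y => |(1 + e * η y) ^ N * (1 + (1 + e * η y)⁻¹ * (e * fderiv ℝ η y y))|
    with hdd
  have hlam : ∀ y, 0 < 1 + e * η y := fun y => by have := hη0 y; positivity
  have hdet : ∀ y, |(1 + fderiv ℝ k y).det| = dd y := by
    intro y
    have : 1 + fderiv ℝ k y = (1 + e * η y) • (1 : EE N →L[ℝ] EE N) +
        (e • fderiv ℝ η y).smulRight y := by
      rw [hkd]; ext1 v; simp [add_smul, smul_smul, add_assoc]
    rw [this, aux_det (hlam y).ne']
    simp [hdd]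
  have hcv : jj g f V = ∫ y, dd y * (Gfun g ‖L y‖ - Gfun f (U y)) := by
    unfold jj
    have := integral_image_eq_integral_abs_det_fderiv_smul (volume : Measure (EE N)) (s := univ)
      (f := Ψ) (f' := fun y => 1 + fderiv ℝ k y) MeasurableSet.univ
      (fun y _ => (hΨd y).hasFDerivWithinAt) Ψ.injective.injOn
      (fun x => Gfun g ‖fderiv ℝ V x‖ - Gfun f (V x))
    rw [image_univ, Ψ.surjective.range_eq, setIntegral_univ, setIntegral_univ] at this
    rw [this]
    simp only [hdet, hVΨ, smul_eq_mul, hL]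
  have hddb : ∀ y, |dd y - (1+e)^N| ≤ 2^N * (e * κ) := by
    intro y
    refine (aux_detbd hN he he1 (hη0 y) (hη1 y)).trans ?_
    gcongr
    rw [hκ]
    have := (fderiv ℝ η y).le_opNorm y
    rw [Real.norm_eq_abs] at this
    linarith [hDηb y]
  have hddc : Continuous dd := by
    have h1 := hη.continuous
    have h2 : Continuous fun y => fderiv ℝ η y y :=
      (hη.continuous_fderiv (by norm_num)).clm_apply continuous_id
    simp only [hdd]
    have h3 : Continuous fun y => (1 + e * η y)⁻¹ :=
      Continuous.inv₀ (by fun_prop) (fun y => (hlam y).ne')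
    fun_prop
  have hLc : Continuous L := (hVc.continuous_fderiv (by norm_num)).comp Ψ.continuous
  have hLs : HasCompactSupport L := by
    apply (hUc.fderiv (𝕜 := ℝ)).mono
    intro y hy
    simp only [Function.mem_support] at hy ⊢
    intro h
    have := hL2 y
    rw [h, norm_zero, mul_zero] at this
    exact hy (norm_le_zero_iff.1 this)
  have hWint : Integrable fun y => dd y * (Gfun g ‖L y‖ - Gfun f (U y)) := by
    have h1 : Integrable fun y => Gfun g ‖L y‖ := by
      apply Continuous.integrable_of_hasCompactSupport
      · exact (aux_Gcont hgc).comp_continuous hLc.norm (fun y => norm_nonneg _)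
      · exact hLs.comp_left (g := fun T => Gfun g ‖T‖) (by simp [aux_Gzero])
    apply (h1.sub hF).bdd_mul (c := (1+e)^N + 2^N * (e * κ)) hddc.aestronglyMeasurable
    refine Filter.Eventually.of_forall fun y => ?_
    rw [Real.norm_eq_abs, abs_of_nonneg (abs_nonneg _)]
    linarith [(abs_le.1 (hddb y)).2]
  set kk : EE N → ℝ := fun y => (1+e)^N * (Gfun g ((1+e)⁻¹ * ‖fderiv ℝ U y‖) - Gfun f (U y)) with hkk
  have hkint : Integrable kk :=
    ((aux_Gp_int hgc hU hUc (by positivity)).sub hF).const_mul _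
  have hKk : Kfun g U (∫ x, Gfun f (U x)) (1 + e) = ∫ y, kk y := by
    simp only [hkk]
    rw [integral_const_mul, integral_sub (aux_Gp_int hgc hU hUc (by positivity)) hF]
    rfl
  set S := {x | x ∈ Ω ∧ infDist x Ωᶜ < 4 * δ} with hS
  have hSf : volume S < ⊤ := by
    refine (measure_mono (t := closedBall 0 R) ?_).trans_lt measure_closedBall_lt_top
    intro x hx; rw [mem_closedBall_zero_iff]; exact hΩR x hx.1
  have hdiff : (∫ y, dd y * (Gfun g ‖L y‖ - Gfun f (U y))) - ∫ y, kk y =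
      ∫ y in S, (dd y * (Gfun g ‖L y‖ - Gfun f (U y)) - kk y) := by
    rw [← integral_sub hWint hkint, setIntegral_eq_integral_of_forall_compl_eq_zero]
    intro y hy
    by_cases hyΩ : y ∈ Ω
    · have h4 : 4 * δ ≤ infDist y Ωᶜ := by
        by_contra! h; exact hy ⟨hyΩ, h⟩
      have hD0 := hDηi y (by linarith)
      have hη1' := hηo y (by linarith)
      have hdd' : dd y = (1+e)^N := by
        simp only [hdd, hD0, hη1', mul_one]
        have h7 : (1 + e) ^ N * (1 + (1 + e)⁻¹ * (e * (0 : EE N →L[ℝ] ℝ) y)) = (1 + e)^N := by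
          simp
        rw [h7, abs_of_pos (by positivity)]
      have hL' : L y = (1+e)⁻¹ • fderiv ℝ U y := by
        have h5 := hUL y
        have h6 : (L y).comp (fderiv ℝ k y) = e • L y := by
          rw [hkd, hD0, hη1']; ext v; simp
        rw [h6] at h5
        rw [h5, smul_add, smul_smul, ← add_smul]
        have : (1+e)⁻¹ + (1+e)⁻¹ * e = 1 := by field_simp
        rw [this, one_smul]
      rw [hdd', hL', norm_smul, Real.norm_of_nonneg (by positivity)]
      simp [hkk]
    · have hz := hU0 y hyΩ
      have hL' : L y = 0 := by
        have := hL2 y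
        rw [hz.2, norm_zero, mul_zero] at this
        exact norm_le_zero_iff.1 this
      simp [hkk, hz.1, hz.2, hL', aux_Gzero]
  have hbound : ‖∫ y in S, (dd y * (Gfun g ‖L y‖ - Gfun f (U y)) - kk y)‖ ≤
      8 * 2^N * (e * κ) * m * volume.real S := by
    apply norm_setIntegral_le_of_norm_le_const hSf
    intro y hy
    rw [Real.norm_eq_abs]
    refine (aux_pt hgc hgm hg0 (norm_nonneg _) (norm_nonneg _) he hκ1 heκ
      ((abs_norm_sub_norm_le _ _).trans (hLd y)) (hddb y)).trans ?_
    gcongr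
    exact hm y hy.1 hy.2
  rw [Real.norm_eq_abs] at hbound
  have := (abs_le.1 hbound).2
  rw [hKk]
  linarith

open Set Metric MeasureTheory Bornology
open scoped RealInnerProductSpace Classical

lemma aux_B {N : ℕ} (hN : 1 ≤ N) {g f : ℝ → ℝ} (hgc : ContinuousOn g (Ici 0))
    (hgm : StrictMonoOn g (Ici 0)) (hg0 : g 0 = 0) {Ω : Set (EE N)}
    (hΩo : IsOpen Ω) (hΩb : IsBounded Ω) (hΩbd : HasC1Boundary Ω)
    {R : ℝ} (hR : 0 < R) (hΩR : ∀ x ∈ Ω, ‖x‖ ≤ R) (hne : Ωᶜ.Nonempty) {U : EE N → ℝ}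
    (hU : ContDiff ℝ 1 U) (hUc : HasCompactSupport U) (hF : Integrable (fun x => Gfun f (U x)))
    (hF0 : ∀ m > (0:ℝ), ∃ s > (0:ℝ), ∀ t, |t| < s → |Gfun f t| < m)
    (hU0 : ∀ x ∉ Ω, U x = 0 ∧ fderiv ℝ U x = 0)
    (hmin : ∃ ε > (0:ℝ), ∀ V : EE N → ℝ, ContDiff ℝ 1 V →
      (∀ x ∉ Ω, V x = 0 ∧ fderiv ℝ V x = 0) →
      (∀ x ∈ Ω, |V x - U x| + ‖fderiv ℝ V x - fderiv ℝ U x‖ < ε) → jj g f U ≤ jj g f V) :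
    ∀ ω > (0:ℝ), ∃ e0 > (0:ℝ), ∀ e, 0 < e → e < e0 →
      Kfun g U (∫ x, Gfun f (U x)) 1 - ω * e ≤ Kfun g U (∫ x, Gfun f (U x)) (1 + e) := by
  intro ω hω
  obtain ⟨C, hC, d1, hd1, hstrip⟩ := aux_strip hΩo hΩb hΩbd hne
  set Q : ℝ := 32 * 2^N * (1 + R) * C with hQ
  have hQp : 0 < Q := by positivity
  set m := ω / Q with hm
  have hmp : 0 < m := by positivity
  obtain ⟨s1, hs1, hs1F⟩ := hF0 (m/2) (by positivity)
  have hg2 : 0 < g 2 := by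
    rw [← hg0]; exact hgm (by simp) (by simp) (by norm_num)
  set s := min s1 (min 1 (m / (4 * g 2))) with hs
  have hsp : 0 < s := by positivity
  obtain ⟨d2, hd2, huc⟩ := aux_uc hU hUc s hsp
  set δ := min (d1/8) (min (d2/4) 1) with hδ
  have hδp : 0 < δ := by positivity
  have hδ1 : δ ≤ d1/8 := min_le_left _ _
  have hδ2 : δ ≤ d2/4 := (min_le_right _ _).trans (min_le_left _ _)
  have hδ3 : δ ≤ 1 := (min_le_right _ _).trans (min_le_right _ _)
  have hstr : ∀ y ∈ Ω, infDist y Ωᶜ < 4 * δ →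
      g (2 * ‖fderiv ℝ U y‖) * ‖fderiv ℝ U y‖ + |Gfun g ‖fderiv ℝ U y‖ - Gfun f (U y)| ≤ m := by
    intro y _ hyd
    obtain ⟨z, hz, hyz⟩ := (infDist_lt_iff hne).1 hyd
    obtain ⟨h1, h2⟩ := huc y z (by linarith)
    rw [(hU0 z hz).1, sub_zero] at h1
    rw [(hU0 z hz).2, sub_zero] at h2
    set p := ‖fderiv ℝ U y‖ with hp
    have hp0 : 0 ≤ p := norm_nonneg _
    have hp1 : p ≤ 1 := h2.le.trans ((min_le_right _ _).trans (min_le_left _ _))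
    have hp2 : p < m / (4 * g 2) := h2.trans_le ((min_le_right _ _).trans (min_le_right _ _))
    have h3 := hs1F (U y) (h1.trans_le (min_le_left _ _))
    have h4 : g (2 * p) ≤ g 2 := hgm.monotoneOn (by simp; linarith) (by simp) (by linarith)
    have h5 : g p ≤ g 2 := hgm.monotoneOn (by simp; linarith) (by simp) (by linarith)
    have h6 := aux_Gbound hgc hgm le_rfl hp0
    have h7 := aux_Gmono hgc hgm hg0 le_rfl hp0
    rw [aux_Gzero] at h6 h7
    have h8 : |Gfun g p - Gfun f (U y)| ≤ |Gfun g p| + |Gfun f (U y)| := abs_sub _ _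
    rw [abs_of_nonneg h7] at h8
    have h9 : 4 * (g 2 * p) < m := by
      rw [lt_div_iff₀ (by positivity)] at hp2; linarith
    have h10 : g (2*p) * p ≤ g 2 * p := by gcongr
    have h11 : g p * p ≤ g 2 * p := by gcongr
    linarith
  obtain ⟨e0, he0, hB⟩ := aux_B1 hN hgc hgm hg0 hR hΩR hU hUc hF hU0 hmin hδp hstr
  refine ⟨e0, he0, fun e he hee => ?_⟩
  have h1 := hB e he hee
  have h2 := hstrip (4 * δ) (by positivity) (by linarith)
  have h3 : 8 * 2^N * (e * (1 + R/δ)) * m * volume.real {x | x ∈ Ω ∧ infDist x Ωᶜ < 4 * δ} ≤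
      ω * e := by
    calc _ ≤ 8 * 2^N * (e * (1 + R/δ)) * m * (C * (4 * δ)) := by gcongr
      _ = 32 * 2^N * (δ + R) * C * m * e := by field_simp; ring
      _ ≤ 32 * 2^N * (1 + R) * C * m * e := by gcongr
      _ = Q * m * e := by rw [hQ]
      _ = ω * e := by rw [hm]; field_simp
  linarith

open Set Metric MeasureTheory Bornology
open scoped RealInnerProductSpace Classical

lemma aux_Fcont_Icc {f : ℝ → ℝ} (hfc : ContinuousOn f (Ici 0)) {a b : ℝ} (ha : a ≤ 0) (hb : 0 ≤ b)
    (hi : IntervalIntegrable f volume 0 a) : ContinuousOn (Gfun f) (Icc a b) := by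
  have h2 : IntervalIntegrable f volume a b := hi.symm.trans (aux_ii hfc le_rfl hb)
  have := intervalIntegral.continuousOn_primitive_interval' h2 (a := 0)
    (by rw [uIcc_of_le (ha.trans hb)]; exact ⟨ha, hb⟩)
  rw [uIcc_of_le (ha.trans hb)] at this
  exact this

lemma aux_F0 {f : ℝ → ℝ} (hfc : ContinuousOn f (Ici 0)) :
    ∀ m > (0:ℝ), ∃ s > (0:ℝ), ∀ t, |t| < s → |Gfun f t| < m := by
  intro m hm
  by_cases h : ∃ σ < 0, IntervalIntegrable f volume 0 σ
  · obtain ⟨σ, hσ, hi⟩ := h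
    have hc := aux_Fcont_Icc hfc hσ.le zero_le_one hi
    have hc0 : ContinuousAt (Gfun f) 0 := hc.continuousAt (Icc_mem_nhds hσ one_pos)
    obtain ⟨s, hs, h⟩ := Metric.continuousAt_iff.1 hc0 m hm
    refine ⟨s, hs, fun t ht => ?_⟩
    have := @h t (by simpa using ht)
    simpa [aux_Gzero] using this
  · push Not at h
    have hc := aux_Gcont hfc
    obtain ⟨s, hs, h1⟩ := Metric.continuousOn_iff.1 hc 0 (by simp) m hm
    refine ⟨s, hs, fun t ht => ?_⟩
    by_cases h0 : 0 ≤ t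
    · have := h1 t h0 (by simpa using ht)
      simpa [aux_Gzero] using this
    · have : Gfun f t = 0 := intervalIntegral.integral_undef (h t (by linarith))
      simpa [this] using hm

lemma aux_Fmeas {f : ℝ → ℝ} (hfc : ContinuousOn f (Ici 0)) : Measurable (Gfun f) := by
  set J : Set ℝ := {t | IntervalIntegrable f volume 0 t} with hJ
  have hpos : ∀ t, 0 ≤ t → t ∈ J := fun t ht => aux_ii hfc le_rfl ht
  have hdown : ∀ a ∈ J, ∀ c, a ≤ c → c ∈ J := by
    intro a ha c hac
    by_cases hc : 0 ≤ c
    · exact hpos c hc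
    · push Not at hc
      apply IntervalIntegrable.mono_set ha
      rw [uIcc_of_ge hc.le, uIcc_of_ge (hac.trans hc.le)]
      exact Icc_subset_Icc_left hac
  have hJm : MeasurableSet J := by
    have : J.OrdConnected := ⟨fun a ha b hb c hc => hdown a ha c hc.1⟩
    exact this.measurableSet
  have hcont : ContinuousOn (Gfun f) J := by
    intro t0 ht0
    have key : ∃ t1 ∈ J, t1 ≤ 0 ∧ t1 ≤ t0 ∧ Icc t1 (|t0|+1) ∈ nhdsWithin t0 J := by
      by_cases h : ∃ t1 ∈ J, t1 < t0
      · obtain ⟨t1, h1, h2⟩ := h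
        refine ⟨min t1 0, ?_, min_le_right _ _, (min_le_left _ _).trans h2.le, ?_⟩
        · rcases min_choice t1 0 with h | h <;> rw [h]
          · exact h1
          · exact hpos 0 le_rfl
        · apply mem_nhdsWithin_of_mem_nhds
          apply Icc_mem_nhds
          · exact (min_le_left _ _).trans_lt h2
          · linarith [le_abs_self t0]
      · push Not at h
        refine ⟨t0, ht0, h 0 (hpos 0 le_rfl), le_rfl, ?_⟩
        have : Iic (|t0|+1) ∈ nhdsWithin t0 J :=
          mem_nhdsWithin_of_mem_nhds (Iic_mem_nhds (by linarith [le_abs_self t0]))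
        filter_upwards [this, self_mem_nhdsWithin] with z h1 h2
        exact ⟨h z h2, h1⟩
    obtain ⟨t1, h1, h2, h3, h4⟩ := key
    have := aux_Fcont_Icc hfc h2 (b := |t0|+1) (by positivity) h1
    exact (this t0 ⟨h3, by linarith [le_abs_self t0]⟩).mono_of_mem_nhdsWithin h4
  have := ContinuousOn.measurable_piecewise (f := Gfun f) (g := fun _ => (0:ℝ)) hcont
    continuousOn_const hJm
  convert this using 1
  funext t
  by_cases h : t ∈ J
  · simp [h]
  · simp [h]; exact intervalIntegral.integral_undef h

lemma aux_1d {w : ℝ → ℝ} {K : NNReal} (hw : LipschitzWith K w) {T σ : ℝ} (hT : 0 ≤ T)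
    (h0 : w 0 ≤ σ) (hTσ : σ ≤ w T) (h : ℝ → ENNReal) :
    ∫⁻ s in Icc (w 0) σ, h s ≤ K * ∫⁻ t in {t | t ∈ Icc 0 T ∧ w t ≤ σ}, h (w t) := by
  set S := {t | t ∈ Icc 0 T ∧ w t ≤ σ} with hS
  have hwc := hw.continuous
  have hSm : MeasurableSet S :=
    measurableSet_Icc.inter (measurableSet_le hwc.measurable measurable_const)
  have hsub : Icc (w 0) σ ⊆ w '' S := by
    intro y hy
    obtain ⟨t, ht, rfl⟩ := intermediate_value_Icc hT hwc.continuousOn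
      (show y ∈ Icc (w 0) (w T) from ⟨hy.1, hy.2.trans hTσ⟩)
    exact ⟨t, ⟨ht, hy.2⟩, rfl⟩
  have hle : volume.restrict (Icc (w 0) σ) ≤ (K : ENNReal) • (volume.restrict S).map w := by
    rw [Measure.le_iff]
    intro B hB
    rw [Measure.restrict_apply hB, Measure.smul_apply, Measure.map_apply hwc.measurable hB,
      Measure.restrict_apply (hwc.measurable hB)]
    have h1 : B ∩ Icc (w 0) σ ⊆ w '' (w ⁻¹' B ∩ S) := by
      rintro y ⟨hyB, hy⟩
      obtain ⟨t, ht, rfl⟩ := hsub hy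
      exact ⟨t, ⟨hyB, ht⟩, rfl⟩
    refine (measure_mono h1).trans ?_
    have := hw.hausdorffMeasure_image_le (d := 1) zero_le_one (w ⁻¹' B ∩ S)
    simpa [hausdorffMeasure_real] using this
  calc ∫⁻ s in Icc (w 0) σ, h s ≤ ∫⁻ s, h s ∂((K : ENNReal) • (volume.restrict S).map w) :=
        lintegral_mono' hle le_rfl
    _ = K * ∫⁻ s, h s ∂((volume.restrict S).map w) := by rw [lintegral_smul_measure]; rfl
    _ ≤ _ := mul_le_mul' le_rfl (lintegral_map_le h w)

open Set Metric MeasureTheory Bornology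
open scoped RealInnerProductSpace Classical

lemma aux_upper {N : ℕ} {p : EE N → ENNReal} (hp : AEMeasurable p volume) :
    ∃ q : EE N → ENNReal, Measurable q ∧ (∀ x, p x ≤ q x) ∧ ∫⁻ x, q x = ∫⁻ x, p x := by
  set Z := toMeasurable volume {x | p x ≠ hp.mk p x} with hZ
  have hZ0 : volume Z = 0 := by
    rw [hZ, measure_toMeasurable]; exact hp.ae_eq_mk
  refine ⟨Z.piecewise (fun _ => ⊤) (hp.mk p), ?_, ?_, ?_⟩
  · exact Measurable.piecewise (measurableSet_toMeasurable _ _) measurable_const hp.measurable_mk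
  · intro x
    by_cases h : x ∈ Z
    · simp [h]
    · simp only [h, not_false_eq_true, piecewise_eq_of_notMem]
      by_contra h2
      apply h
      apply subset_toMeasurable
      simp only [mem_ofPred_eq]
      intro h3; exact h2 h3.le
  · apply lintegral_congr_ae
    have h1 : ∀ᵐ x, x ∉ Z := measure_eq_zero_iff_ae_notMem.1 hZ0
    filter_upwards [h1, hp.ae_eq_mk] with x h2 h3
    simp [h2, h3]

lemma aux_Fint_crit {N : ℕ} {h : EE N → ℝ} (hm : Measurable h) {R C : ℝ} {Q : EE N → ENNReal}
    (hQ : ∫⁻ x, Q x < ⊤) (hb : ∀ x, ‖x‖ ≤ R → ‖h x‖ₑ ≤ ENNReal.ofReal C + Q x)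
    (h0 : ∀ x, R < ‖x‖ → h x = 0) : Integrable h := by
  refine ⟨hm.aestronglyMeasurable, ?_⟩
  have hle : ∀ x, ‖h x‖ₑ ≤ (closedBall (0:EE N) R).indicator (fun _ => ENNReal.ofReal C) x + Q x := by
    intro x
    by_cases hx : ‖x‖ ≤ R
    · have : x ∈ closedBall (0:EE N) R := by simpa using hx
      rw [indicator_of_mem this]; exact hb x hx
    · rw [h0 x (not_le.1 hx)]; simp
  refine (lintegral_mono hle).trans_lt ?_
  rw [lintegral_add_left (measurable_const.indicator measurableSet_closedBall),
    lintegral_indicator measurableSet_closedBall, setLIntegral_const]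
  refine ENNReal.add_lt_top.2 ⟨ENNReal.mul_lt_top ENNReal.ofReal_lt_top ?_, hQ⟩
  exact measure_closedBall_lt_top

lemma aux_Fint {N : ℕ} (hN : 1 ≤ N) {f : ℝ → ℝ} (hfc : ContinuousOn f (Ici 0)) {U : EE N → ℝ}
    (hU : ContDiff ℝ 1 U) (hUc : HasCompactSupport U) {R : ℝ} (hR : 0 < R)
    (hUR : ∀ x, R < ‖x‖ → U x = 0)
    (hfU : ∀ σ < 0, IntegrableOn (fun x => f (U x)) {x | U x ≤ σ}) :
    Integrable (fun x => Gfun f (U x)) := by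
  have hm : Measurable (fun x => Gfun f (U x)) := (aux_Fmeas hfc).comp hU.continuous.measurable
  have h0 : ∀ x, R < ‖x‖ → Gfun f (U x) = 0 := fun x hx => by rw [hUR x hx, aux_Gzero]
  obtain ⟨m, hm0, hmb⟩ : ∃ m : ℝ, 0 ≤ m ∧ ∀ x, U x ≤ m := by
    obtain ⟨C, hC⟩ := hU.continuous.bounded_above_of_compact_support hUc
    exact ⟨C, (norm_nonneg _).trans (hC 0), fun x => (le_abs_self _).trans (hC x)⟩
  by_cases h : ∃ σ < 0, IntervalIntegrable f volume 0 σ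
  · obtain ⟨σ, hσ, hi⟩ := h
    obtain ⟨C, hC⟩ := isCompact_Icc.exists_bound_of_continuousOn
      (aux_Fcont_Icc hfc hσ.le hm0 hi)
    obtain ⟨M, hM, hMb⟩ := aux_bd hU hUc
    have hDm : MeasurableSet {x | U x ≤ σ} :=
      measurableSet_le hU.continuous.measurable measurable_const
    have hfD := hfU σ hσ
    obtain ⟨q, hqm, hpq, hqi⟩ := aux_upper
      (p := {x | U x ≤ σ}.indicator (fun x => ‖f (U x)‖ₑ)) (by
        rw [aemeasurable_indicator_iff hDm]
        exact hfD.1.enorm)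
    have hqfin : ∫⁻ x, q x < ⊤ := by
      rw [hqi, lintegral_indicator hDm]; exact hfD.2
    set e : EE N := EuclideanSpace.single ⟨0, hN⟩ (1:ℝ) with he
    have hen : ‖e‖ = 1 := by simp [he]
    set T : ℝ := 2 * R + 1 with hT
    refine aux_Fint_crit hm (R := R) (C := C)
      (Q := fun x => (M.toNNReal : ENNReal) * ∫⁻ t in Icc 0 T, q (x + t • e)) ?_ ?_ h0
    · rw [lintegral_const_mul' _ _ ENNReal.coe_ne_top]
      refine ENNReal.mul_lt_top ENNReal.coe_lt_top ?_
      rw [lintegral_lintegral_swap]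
      · simp_rw [lintegral_add_right_eq_self q]
        rw [setLIntegral_const]
        exact ENNReal.mul_lt_top hqfin measure_Icc_lt_top
      · apply Measurable.aemeasurable
        apply hqm.comp
        fun_prop
    · intro x hx
      by_cases hxσ : σ ≤ U x
      · refine le_trans ?_ le_self_add
        rw [← ofReal_norm]
        exact ENNReal.ofReal_le_ofReal (hC _ ⟨hxσ, hmb x⟩)
      push Not at hxσ
      by_cases hxJ : IntervalIntegrable f volume 0 (U x)
      · have h1 : Gfun f (U x) = Gfun f σ - ∫ s in (U x)..σ, f s := by
          unfold Gfun
          rw [← intervalIntegral.integral_add_adjacent_intervals hxJ (hxJ.symm.trans hi)]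
          ring
        rw [h1]
        refine (enorm_sub_le).trans ?_
        refine add_le_add ?_ ?_
        · rw [← ofReal_norm]
          exact ENNReal.ofReal_le_ofReal (hC _ ⟨le_rfl, hσ.le.trans hm0⟩)
        · set w : ℝ → ℝ := fun t => U (x + t • e) with hw
          have hwL : LipschitzWith M.toNNReal w := by
            have hUL : LipschitzWith M.toNNReal U := by
              apply lipschitzWith_of_nnnorm_fderiv_le (𝕜 := ℝ) (hU.differentiable (by norm_num))
              intro y
              rw [← NNReal.coe_le_coe]
              simp only [coe_nnnorm, Real.coe_toNNReal _ hM.le]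
              exact hMb y
            have hl : LipschitzWith 1 (fun t : ℝ => x + t • e) := by
              apply LipschitzWith.of_dist_le_mul
              intro a b
              rw [dist_add_left, dist_eq_norm, ← sub_smul, norm_smul, hen, Real.dist_eq]
              simp
            have h2 := hUL.comp hl
            rw [mul_one] at h2
            exact h2
          have hw0 : w 0 = U x := by simp [hw]
          have hwT : w T = 0 := by
            apply hUR
            have : ‖T • e‖ ≤ ‖x + T • e‖ + ‖x‖ := by
              have := norm_sub_le (x + T • e) x
              simpa using this
            rw [norm_smul, hen, Real.norm_of_nonneg (by positivity)] at this
            linarith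
          have key := aux_1d hwL (T := T) (σ := σ) (by positivity) (by rw [hw0]; exact hxσ.le)
            (by rw [hwT]; exact hσ.le) (fun s => ‖f s‖ₑ)
          rw [hw0] at key
          rw [intervalIntegral.integral_of_le hxσ.le]
          refine (enorm_integral_le_lintegral_enorm _).trans ?_
          refine (lintegral_mono_set Ioc_subset_Icc_self).trans (key.trans ?_)
          refine mul_le_mul' le_rfl ?_
          have hSm : MeasurableSet {t | t ∈ Icc 0 T ∧ w t ≤ σ} :=
            measurableSet_Icc.inter (measurableSet_le hwL.continuous.measurable measurable_const)
          refine le_trans (setLIntegral_mono' hSm (g := fun t => q (x + t • e)) ?_)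
            (lintegral_mono_set (fun t ht => ht.1))
          intro t ht
          have h3 := hpq (x + t • e)
          have h4 : x + t • e ∈ {x | U x ≤ σ} := ht.2
          rw [indicator_of_mem h4] at h3
          exact h3
      · have : Gfun f (U x) = 0 := intervalIntegral.integral_undef hxJ
        rw [this]; simp
  · push Not at h
    obtain ⟨C, hC⟩ := isCompact_Icc.exists_bound_of_continuousOn
      ((aux_Gcont hfc).mono (Icc_subset_Ici_self : Icc 0 m ⊆ _))
    refine aux_Fint_crit hm (R := R) (C := C) (Q := fun _ => 0) (by simp) ?_ h0
    intro x _
    by_cases hx : 0 ≤ U x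
    · rw [← ofReal_norm, add_zero]
      exact ENNReal.ofReal_le_ofReal (hC _ ⟨hx, hmb x⟩)
    · have : Gfun f (U x) = 0 := intervalIntegral.integral_undef (h _ (by linarith))
      rw [this]; simp

open Set Metric MeasureTheory Bornology
open scoped RealInnerProductSpace Classical
open scoped Convolution

lemma aux_moll {N : ℕ} {Ω : Set (EE N)} (hΩo : IsOpen Ω) {W : EE N → ℝ} (hW : ContDiff ℝ 1 W)
    (hWc : HasCompactSupport W) (hWs : tsupport W ⊆ Ω) {η : ℝ} (hη : 0 < η) :
    ∃ φ, IsTestFun Ω φ ∧ ∀ x, ‖fderiv ℝ φ x - fderiv ℝ W x‖ ≤ η := by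
  obtain ⟨d, hd, hdΩ⟩ := IsCompact.exists_cthickening_subset_open hWc hΩo hWs
  have hfc : Continuous (fderiv ℝ W) := hW.continuous_fderiv (by norm_num)
  have huc := (hWc.fderiv (𝕜 := ℝ)).uniformContinuous_of_continuous hfc
  obtain ⟨s, hs, hsu⟩ := Metric.uniformContinuous_iff.1 huc η hη
  have hr : 0 < min s d := lt_min hs hd
  set b : ContDiffBump (0 : EE N) := ⟨min s d / 2, min s d, by positivity, by linarith⟩ with hb
  set k : EE N → ℝ := b.normed volume with hk
  have hkc : Continuous k := b.continuous_normed
  have hks : HasCompactSupport k := b.hasCompactSupport_normed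
  set φ : EE N → ℝ := k ⋆[ContinuousLinearMap.lsmul ℝ ℝ, volume] W with hφ
  have hφs : tsupport φ ⊆ cthickening d (tsupport W) := by
    apply closure_minimal _ isClosed_cthickening
    refine (support_convolution_subset_swap _).trans ?_
    rintro _ ⟨y, hy, z, hz, rfl⟩
    rw [hk, b.support_normed_eq] at hz
    have hz1 : ‖z‖ < min s d := mem_ball_zero_iff.1 hz
    apply mem_cthickening_of_dist_le (y + z) y d _ (subset_tsupport _ hy)
    simp only [dist_self_add_left]
    exact hz1.le.trans (min_le_right _ _)
  refine ⟨φ, ⟨?_, ?_, hφs.trans hdΩ⟩, ?_⟩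
  · exact hks.contDiff_convolution_left _ b.contDiff_normed hW.continuous.locallyIntegrable
  · exact hks.convolution _ hWc
  · intro x
    have h1 := hWc.hasFDerivAt_convolution_right (ContinuousLinearMap.lsmul ℝ ℝ)
      (f := k) (μ := volume) hkc.locallyIntegrable hW x
    have h2 : (k ⋆[ContinuousLinearMap.precompR (EE N) (ContinuousLinearMap.lsmul ℝ ℝ), volume]
        fderiv ℝ W) x = (k ⋆[ContinuousLinearMap.lsmul ℝ ℝ, volume] fderiv ℝ W) x := by
      unfold convolution
      congr 1
    rw [h1.fderiv, h2, ← dist_eq_norm]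
    apply b.dist_normed_convolution_le hfc.aestronglyMeasurable
    intro y hy
    have : dist y x < min s d := hy
    exact (hsu (this.trans_le (min_le_left _ _))).le

lemma aux_gvec_norm {N : ℕ} {g : ℝ → ℝ} (hgm : StrictMonoOn g (Ici 0)) (hg0 : g 0 = 0)
    (y : EE N) : ‖gvec g y‖ = g ‖y‖ := by
  unfold gvec
  split_ifs with h
  · simp [h, hg0]
  · have : ‖y‖ ≠ 0 := by simpa using h
    rw [norm_smul, norm_div, norm_norm, Real.norm_of_nonneg (aux_gnn hgm hg0 (norm_nonneg _))]
    field_simp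

lemma aux_gvec_cont {N : ℕ} {g : ℝ → ℝ} (hgc : ContinuousOn g (Ici 0))
    (hgm : StrictMonoOn g (Ici 0)) (hg0 : g 0 = 0) :
    Continuous (gvec g : EE N → EE N) := by
  have hc : Continuous (fun y : EE N => g ‖y‖) :=
    hgc.comp_continuous continuous_norm (fun y => norm_nonneg y)
  rw [continuous_iff_continuousAt]
  intro y
  by_cases h : y = 0
  · subst h
    have h0 : gvec g (0 : EE N) = 0 := by simp [gvec]
    unfold ContinuousAt
    rw [h0, tendsto_zero_iff_norm_tendsto_zero]
    simp_rw [aux_gvec_norm hgm hg0]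
    have := hc.tendsto 0
    simpa [hg0] using this
  · have h1 : (fun z : EE N => (g ‖z‖ / ‖z‖) • z) =ᶠ[nhds y] gvec g := by
      filter_upwards [isOpen_ne.mem_nhds h] with z hz
      simp only [gvec]; rw [if_neg hz]
    refine ContinuousAt.congr ?_ h1
    have h2 : ContinuousAt (fun z : EE N => g ‖z‖ / ‖z‖) y :=
      ContinuousAt.div hc.continuousAt (continuous_norm (E := EE N)).continuousAt
        (by simpa using h)
    exact h2.smul continuousAt_id

lemma aux_gvec_inner {N : ℕ} {g : ℝ → ℝ} (y : EE N) : ⟪y, gvec g y⟫ = g ‖y‖ * ‖y‖ := by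
  unfold gvec
  split_ifs with h
  · simp [h]
  · have : ‖y‖ ≠ 0 := by simpa using h
    rw [real_inner_smul_right, real_inner_self_eq_norm_sq]
    field_simp

lemma aux_inner_grad {N : ℕ} (φ : EE N → ℝ) (x v : EE N) :
    ⟪v, gradient φ x⟫ = fderiv ℝ φ x v := by
  rw [real_inner_comm]; unfold gradient
  exact InnerProductSpace.toDual_symm_apply

lemma aux_sqpos : ∃ h : ℝ → ℝ, (∀ s, HasDerivAt h (max s 0) s) ∧ (∀ s ≤ 0, h s = 0) ∧
    (∀ s > 0, 0 < h s) := by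
  have hc : Continuous (fun r : ℝ => max r 0) := by fun_prop
  refine ⟨fun s => ∫ r in (0:ℝ)..s, max r 0, fun s => ?_, fun s hs => ?_, fun s hs => ?_⟩
  · exact (hc.integral_hasStrictDerivAt 0 s).hasDerivAt
  · have : ∫ r in (0:ℝ)..s, max r 0 = ∫ r in (0:ℝ)..s, (0:ℝ) := by
      apply intervalIntegral.integral_congr
      intro r hr
      rw [uIcc_of_ge hs] at hr
      exact max_eq_right hr.2
    simp [this]
  · have : ∫ r in (0:ℝ)..s, max r 0 = ∫ r in (0:ℝ)..s, r := by
      apply intervalIntegral.integral_congr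
      intro r hr
      rw [uIcc_of_le hs.le] at hr
      exact max_eq_left hr.1
    simp only [this, integral_id]
    have hs2 : 0 < s ^ 2 := pow_pos hs 2
    linarith

lemma aux_nonneg {N : ℕ} {g : ℝ → ℝ} (hgc : ContinuousOn g (Ici 0))
    (hgm : StrictMonoOn g (Ici 0)) (hg0 : g 0 = 0) {Ω : Set (EE N)} (hΩo : IsOpen Ω)
    (hΩb : IsBounded Ω) (hne : Ωᶜ.Nonempty) {U : EE N → ℝ} (hU : ContDiff ℝ 1 U)
    (hUc : HasCompactSupport U) (hU0 : ∀ x ∉ Ω, U x = 0)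
    (hL : ∀ φ, IsTestFun Ω φ → ∫ x in Ω, ⟪gvec g (gradient U x), gradient φ x⟫ = 0) :
    ∀ x, 0 ≤ U x := by
  have hgr : Continuous (gradient U) := by
    have h1 := hU.continuous_fderiv (by norm_num)
    unfold gradient
    exact (InnerProductSpace.toDual ℝ (EE N)).symm.continuous.comp h1
  set V : EE N → EE N := fun x => gvec g (gradient U x) with hV
  have hVc : Continuous V := (aux_gvec_cont hgc hgm hg0).comp hgr
  have hVs : HasCompactSupport V := by
    have h1 := hUc.fderiv (𝕜 := ℝ)
    apply h1.comp_left (g := fun L => gvec g ((InnerProductSpace.toDual ℝ (EE N)).symm L))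
    simp [gvec]
  have hVi : Integrable (fun x => ‖V x‖) :=
    hVc.norm.integrable_of_hasCompactSupport hVs.norm
  have hL' : ∀ φ, IsTestFun Ω φ → ∫ x, fderiv ℝ φ x (V x) = 0 := by
    intro φ hφ
    rw [← setIntegral_eq_integral_of_forall_compl_eq_zero (s := Ω), ← hL φ hφ]
    · simp_rw [aux_inner_grad]; rfl
    · intro x hx
      have : x ∉ tsupport (fderiv ℝ φ) := fun h => hx (hφ.2.2 (tsupport_fderiv_subset ℝ h))
      rw [image_eq_zero_of_notMem_tsupport this]; simp
  have hLW : ∀ W : EE N → ℝ, ContDiff ℝ 1 W → HasCompactSupport W → tsupport W ⊆ Ω →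
      ∫ x, fderiv ℝ W x (V x) = 0 := by
    intro W hW hWc hWs
    have hintg : ∀ φ : EE N → ℝ, ContDiff ℝ 1 φ → Integrable (fun x => fderiv ℝ φ x (V x)) := by
      intro φ hφ
      have h1 := hφ.continuous_fderiv (by norm_num)
      apply Continuous.integrable_of_hasCompactSupport (h1.clm_apply hVc)
      apply hVs.mono
      intro x hx h2
      apply hx; simp [h2]
    have hbd : ∀ η > 0, ‖∫ x, fderiv ℝ W x (V x)‖ ≤ η * ∫ x, ‖V x‖ := by
      intro η hη
      obtain ⟨φ, hφ, hφd⟩ := aux_moll hΩo hW hWc hWs hη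
      have hφ1 : ContDiff ℝ 1 φ := hφ.1.of_le (by exact_mod_cast le_top)
      have h3 : ∫ x, fderiv ℝ W x (V x) = ∫ x, (fderiv ℝ W x (V x) - fderiv ℝ φ x (V x)) := by
        rw [integral_sub (hintg W hW) (hintg φ hφ1), hL' φ hφ, sub_zero]
      rw [h3, ← integral_const_mul]
      apply norm_integral_le_of_norm_le (hVi.const_mul _)
      refine Filter.Eventually.of_forall fun x => ?_
      rw [norm_sub_rev, ← _root_.sub_apply]
      exact (ContinuousLinearMap.le_opNorm _ _).trans
        (mul_le_mul_of_nonneg_right (hφd x) (norm_nonneg _))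
    have hI : 0 ≤ ∫ x, ‖V x‖ := integral_nonneg fun x => norm_nonneg _
    by_contra h0
    have hp : 0 < ‖∫ x, fderiv ℝ W x (V x)‖ := norm_pos_iff.2 h0
    have := hbd (‖∫ x, fderiv ℝ W x (V x)‖ / (2 * ((∫ x, ‖V x‖) + 1))) (by positivity)
    rw [div_mul_eq_mul_div, le_div_iff₀ (by positivity)] at this
    nlinarith
  obtain ⟨h, hh, hh0, hhp⟩ := aux_sqpos
  have hhC : ContDiff ℝ 1 h := by
    rw [contDiff_one_iff_deriv]
    refine ⟨fun s => (hh s).differentiableAt, ?_⟩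
    have : deriv h = fun s => max s 0 := funext fun s => (hh s).deriv
    rw [this]; fun_prop
  have main : ∀ m > 0, ∀ x, -m ≤ U x := by
    intro m hm
    set W : EE N → ℝ := fun x => h (-U x - m) with hW
    have hWC : ContDiff ℝ 1 W := hhC.comp (hU.neg.sub contDiff_const)
    have hWt : tsupport W ⊆ {x | U x ≤ -m} := by
      apply closure_minimal _ (isClosed_le hU.continuous continuous_const)
      intro x hx
      by_contra hc
      simp only [mem_ofPred_eq, not_le] at hc
      exact hx (hh0 _ (by linarith))
    have hWs : tsupport W ⊆ Ω := by
      intro x hx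
      by_contra hc
      have h1 : U x ≤ -m := hWt hx
      rw [hU0 x hc] at h1; linarith
    have hWc : HasCompactSupport W :=
      isCompact_of_isClosed_isBounded (isClosed_tsupport _) (hΩb.subset hWs)
    have hWd : ∀ x, HasFDerivAt W ((max (-U x - m) 0) • (-fderiv ℝ U x)) x := by
      intro x
      have h1 : HasFDerivAt (fun x => -U x - m) (-fderiv ℝ U x) x :=
        ((hU.differentiable (by norm_num) x).hasFDerivAt.neg).sub_const m
      exact (hh (-U x - m)).comp_hasFDerivAt x h1
    have hIntg0 := hLW W hWC hWc hWs
    have hval : ∀ x, fderiv ℝ W x (V x) =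
        -((max (-U x - m) 0) * (g ‖gradient U x‖ * ‖gradient U x‖)) := by
      intro x
      rw [(hWd x).fderiv, ← aux_gvec_inner, real_inner_comm, aux_inner_grad]
      simp [hV]
    simp_rw [hval, integral_neg, neg_eq_zero] at hIntg0
    have hz : ∀ x, (max (-U x - m) 0) * (g ‖gradient U x‖ * ‖gradient U x‖) = 0 := by
      by_contra! hne
      obtain ⟨x, hx⟩ := hne
      have hgg : Continuous (fun x => g ‖gradient U x‖) :=
        hgc.comp_continuous hgr.norm (fun y => norm_nonneg _)
      have hUcont := hU.continuous
      refine absurd hIntg0 (ne_of_gt (Continuous.integral_pos_of_hasCompactSupport_nonneg_nonzero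
        (((hUcont.neg.sub continuous_const).max continuous_const).mul (hgg.mul hgr.norm)) ?_ ?_ hx))
      · apply hVs.mono
        intro y hy h2
        apply hy
        have : ‖V y‖ = 0 := by simp [h2]
        rw [hV, aux_gvec_norm hgm hg0] at this
        simp [this]
      · intro y
        have := aux_gnn hgm hg0 (norm_nonneg (gradient U y))
        simp only [Pi.zero_apply]
        positivity
    have hWz : ∀ x, fderiv ℝ W x = 0 := by
      intro x
      rw [(hWd x).fderiv]
      rcases mul_eq_zero.1 (hz x) with h1 | h1
      · rw [h1]; simp
      · have h2 : ‖gradient U x‖ = 0 := by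
          rcases mul_eq_zero.1 h1 with h3 | h3
          · by_contra h4
            have h5 : 0 < ‖gradient U x‖ := lt_of_le_of_ne (norm_nonneg _) (Ne.symm h4)
            have := hgm (by simp) h5.le h5
            rw [hg0, h3] at this; exact lt_irrefl _ this
          · exact h3
        rw [aux_norm_grad, norm_eq_zero] at h2
        rw [h2]; simp
    obtain ⟨y, hy⟩ := hne
    intro x
    have h1 := is_const_of_fderiv_eq_zero (𝕜 := ℝ) (hWC.differentiable (by norm_num)) hWz x y
    have h2 : W y = 0 := hh0 _ (by rw [hU0 y hy]; linarith)
    rw [h2] at h1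
    by_contra hc
    have := hhp (-U x - m) (by linarith)
    exact absurd h1 this.ne'
  intro x
  by_contra hx
  have := main (-U x / 2) (by linarith) x
  linarith

open Set Metric MeasureTheory Bornology
open scoped RealInnerProductSpace Classical

lemma aux_fU {N : ℕ} {g f : ℝ → ℝ} (hgc : ContinuousOn g (Ici 0))
    (hgm : StrictMonoOn g (Ici 0)) (hg0 : g 0 = 0) {Ω : Set (EE N)} (hΩo : IsOpen Ω)
    (hΩb : IsBounded Ω) (hne : Ωᶜ.Nonempty) {U : EE N → ℝ} (hU : ContDiff ℝ 1 U)
    (hUc : HasCompactSupport U) (hU0 : ∀ x ∉ Ω, U x = 0)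
    (hL : ∀ φ, IsTestFun Ω φ → ∫ x in Ω, ⟪gvec g (gradient U x), gradient φ x⟫ =
      ∫ x in Ω, f (U x) * φ x) :
    ∀ σ < 0, IntegrableOn (fun x => f (U x)) {x | U x ≤ σ} := by
  intro σ hσ
  by_contra hn
  set D : Set (EE N) := {x | U x ≤ σ} with hD
  have hDΩ : D ⊆ Ω := by
    intro x hx
    by_contra hc
    have h1 : U x ≤ σ := hx
    rw [hU0 x hc] at h1; linarith
  have hDc : IsClosed D := isClosed_le hU.continuous continuous_const
  have hDk : IsCompact D := isCompact_of_isClosed_isBounded hDc (hΩb.subset hDΩ)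
  obtain ⟨d, hd, hdΩ⟩ := hDk.exists_cthickening_subset_open hΩo hDΩ
  obtain ⟨ψ, hψs, hψC, -⟩ := IsOpen.exists_contDiff_support_eq (n := ⊤)
    (isOpen_thickening (δ := d) (E := D))
  have hψt : tsupport ψ ⊆ Ω := by
    unfold tsupport; rw [hψs]
    exact (closure_thickening_subset_cthickening _ _).trans hdΩ
  have hψT : IsTestFun Ω ψ :=
    ⟨hψC, isCompact_of_isClosed_isBounded (isClosed_tsupport _) (hΩb.subset hψt), hψt⟩
  have hψn : ¬ IntegrableOn (fun x => f (U x) * ψ x) Ω := by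
    intro hi
    apply hn
    have h1 := hi.mono_set hDΩ
    have h0 : ∀ x ∈ D, ψ x ≠ 0 := by
      intro x hx
      have : x ∈ Function.support ψ := by rw [hψs]; exact self_subset_thickening hd D hx
      exact this
    have h2 : ContinuousOn (fun x => (ψ x)⁻¹) D := hψC.continuous.continuousOn.inv₀ h0
    have h3 := h1.mul_continuousOn h2 hDk
    refine h3.congr_fun ?_ hDc.measurableSet
    intro x hx
    have := h0 x hx
    simp only
    field_simp
  have hgr : Continuous (gradient U) := by
    have h1 := hU.continuous_fderiv (by norm_num)
    unfold gradient
    exact (InnerProductSpace.toDual ℝ (EE N)).symm.continuous.comp h1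
  have hVc : Continuous (fun x => gvec g (gradient U x)) := (aux_gvec_cont hgc hgm hg0).comp hgr
  have hIntg0 : ∀ φ, IsTestFun Ω φ →
      Integrable (fun x => fderiv ℝ φ x (gvec g (gradient U x))) (volume.restrict Ω) := by
    intro φ hφ
    apply Integrable.integrableOn
    have h1 := hφ.1.continuous_fderiv (by simp)
    apply Continuous.integrable_of_hasCompactSupport (h1.clm_apply hVc)
    apply (hφ.2.1.fderiv (𝕜 := ℝ)).mono
    intro x hx h2
    apply hx; simp [h2]
  have hz : ∀ φ, IsTestFun Ω φ → ¬ IntegrableOn (fun x => f (U x) * φ x) Ω →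
      ∫ x in Ω, ⟪gvec g (gradient U x), gradient φ x⟫ = 0 := by
    intro φ hφ h
    rw [hL φ hφ]; exact integral_undef h
  have hL0 : ∀ φ, IsTestFun Ω φ → ∫ x in Ω, ⟪gvec g (gradient U x), gradient φ x⟫ = 0 := by
    intro φ hφ
    by_cases hi : IntegrableOn (fun x => f (U x) * φ x) Ω
    · have hs : IsTestFun Ω (fun x => φ x + ψ x) := by
        refine ⟨hφ.1.add hψC, hφ.2.1.add hψT.2.1, ?_⟩
        exact (tsupport_add φ ψ).trans (union_subset hφ.2.2 hψt)
      have hsn : ¬ IntegrableOn (fun x => f (U x) * (φ x + ψ x)) Ω := by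
        intro h
        apply hψn
        refine (h.sub hi).congr (Filter.Eventually.of_forall fun x => ?_)
        simp only [Pi.sub_apply]; ring
      have e1 := hz _ hs hsn
      have e2 := hz _ hψT hψn
      simp_rw [aux_inner_grad] at e1 e2 ⊢
      have e3 : ∀ x, fderiv ℝ (fun x => φ x + ψ x) x = fderiv ℝ φ x + fderiv ℝ ψ x := fun x =>
        fderiv_fun_add (hφ.1.differentiable (by simp) x) (hψC.differentiable (by simp) x)
      simp_rw [e3, _root_.add_apply] at e1
      rw [integral_add (hIntg0 φ hφ) (hIntg0 ψ hψT), e2, add_zero] at e1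
      exact e1
    · exact hz φ hφ hi
  have hnn := aux_nonneg hgc hgm hg0 hΩo hΩb hne hU hUc hU0 hL0
  have hDe : D = ∅ := by
    ext x
    simp only [hD, mem_ofPred_eq, mem_empty_iff_false, iff_false, not_le]
    linarith [hnn x]
  apply hn
  rw [hDe]; exact integrableOn_empty


/-- Lemma 4.3: in a bounded starshaped `C¹` domain, if `t ↦ g(t)·t^{1-N}` is strictly
decreasing, then a local minimizer of `J` in `X` solving the Euler–Lagrange equation with
homogeneous Neumann condition vanishes identically. -/
theorem starshaped_local_minimizer_trivial
    {N : ℕ} (hN : 1 ≤ N) (Ω : Set (EuclideanSpace ℝ (Fin N)))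
    (hΩo : IsOpen Ω) (hΩconn : IsConnected Ω) (hΩb : IsBounded Ω) (hΩbd : HasC1Boundary Ω)
    (hstar : ∀ x ∈ Ω, ∀ t ∈ Icc (0:ℝ) 1, t • x ∈ Ω)
    (g f : ℝ → ℝ)
    (hgc : ContinuousOn g (Ici 0)) (hg1 : ContDiffOn ℝ 1 g (Ioi 0))
    (hgm : StrictMonoOn g (Ici 0)) (hg0 : g 0 = 0)
    (hfc : ContinuousOn f (Ici 0))
    (hmon : StrictAntiOn (fun t : ℝ => g t * t ^ (1 - (N:ℝ))) (Ioi 0))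
    (u : EuclideanSpace ℝ (Fin N) → ℝ)
    (hmin : IsLocalMinJ g f Ω u) (hsol : IsDistribSolAut Ω g f u)
    (hneu : NeumannZero Ω u) :
    ∀ x ∈ closure Ω, u x = 0 := by
  classical
  obtain ⟨hC, hD0, hcl⟩ := aux_ext hΩo hΩbd hmin.1 hneu
  set U : EE N → ℝ := Ω.indicator u with hUdef
  have hUz : ∀ x ∉ Ω, U x = 0 := fun x hx => indicator_of_notMem hx u
  have hU0 : ∀ x ∉ Ω, U x = 0 ∧ fderiv ℝ U x = 0 := fun x hx => ⟨hUz x hx, hD0 x hx⟩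
  have huU : ∀ x ∈ Ω, u x = U x := fun x hx => (indicator_of_mem hx u).symm
  obtain ⟨R0, hR0⟩ := hΩb.exists_norm_le
  set R : ℝ := max R0 1 with hRdef
  have hR : 0 < R := lt_of_lt_of_le one_pos (le_max_right _ _)
  have hΩR : ∀ x ∈ Ω, ‖x‖ ≤ R := fun x hx => (hR0 x hx).trans (le_max_left _ _)
  have hout : ∀ x, R < ‖x‖ → x ∉ Ω := fun x hx hxΩ => absurd (hΩR x hxΩ) (not_le.2 hx)
  have hUR : ∀ x, R < ‖x‖ → U x = 0 := fun x hx => hUz x (hout x hx)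
  have hUc : HasCompactSupport U := by
    apply HasCompactSupport.intro (isCompact_closedBall (0 : EE N) R)
    intro x hx
    apply hUR
    simpa using hx
  have hne : Ωᶜ.Nonempty := by
    refine ⟨EuclideanSpace.single ⟨0, hN⟩ (R + 1), ?_⟩
    apply hout
    rw [EuclideanSpace.norm_single, Real.norm_of_nonneg (by linarith)]
    linarith
  have hsolU : ∀ φ, IsTestFun Ω φ → ∫ x in Ω, ⟪gvec g (gradient U x), gradient φ x⟫ =
      ∫ x in Ω, f (U x) * φ x := by
    intro φ hφ
    have h1 := hsol φ hφ
    have e1 : ∫ x in Ω, ⟪gvec g (gradient U x), gradient φ x⟫ =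
        ∫ x in Ω, ⟪gvec g (gradient u x), gradient φ x⟫ := by
      apply setIntegral_congr_fun hΩo.measurableSet
      intro x hx
      have he : U =ᶠ[nhds x] u := by
        filter_upwards [hΩo.mem_nhds hx] with z hz using (huU z hz).symm
      have : gradient U x = gradient u x := by unfold gradient; rw [he.fderiv_eq]
      simp only [this]
    have e2 : ∫ x in Ω, f (U x) * φ x = ∫ x in Ω, f (u x) * φ x := by
      apply setIntegral_congr_fun hΩo.measurableSet
      intro x hx
      simp only [huU x hx]
    rw [e1, e2]; exact h1
  have hF : Integrable (fun x => Gfun f (U x)) :=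
    aux_Fint hN hfc hC hUc hR hUR (aux_fU hgc hgm hg0 hΩo hΩb hne hC hUc hUz hsolU)
  have hm := aux_min hΩo huU hU0 hmin
  have hA := aux_A hgc hR hΩR hstar hC hUc hF hU0 hm
  have hB := aux_B hN hgc hgm hg0 hΩo hΩb hΩbd hR hΩR hne hC hUc hF (aux_F0 hfc) hU0 hm
  have hfin := aux_final hN hgc hmon hC hUc _ hA hB
  obtain ⟨y, hy⟩ := hne
  intro x hx
  rw [← hcl x hx, is_const_of_fderiv_eq_zero (𝕜 := ℝ) (hC.differentiable (by norm_num)) hfin x y]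
  exact hUz y hy
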